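/- Let n ≥ 3 and 0 ≤ i ≤ n. The i-th rational Betti number of the small cover X(P₅ × I^{n−2}, χ') is β_i = 2·C(n−2, i−1) + C(n−2, i) if i is even, and β_i = 2·C(n−2, i−1) + C(n−2, i−2) if i is odd. -/

import Mathlib

open Complex CategoryTheory

/-- The vertices of a convex pentagon `P₅ ⊂ ℝ² = ℂ` (the 5th roots of unity), in cyclic
order; `pentVertex 5 = pentVertex 0`. -/
noncomputable def pentVertex (k : ℕ) : ℂ :=
  Complex.exp (2 * Real.pi * Complex.I * k / 5)

/-- The convex pentagon `P₅ ⊂ ℝ² = ℂ`, with edges `E_{k+1} = [pentVertex k, pentVertex (k+1)]`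
in cyclic order. -/
noncomputable def Pentagon : Set ℂ :=
  convexHull ℝ (Set.range fun k : Fin 5 => pentVertex k)

/-- Points of the `n`-dimensional simple polytope `P = P₅ × [−1,1]^{n−2}`. -/
abbrev PentPrismPt (n : ℕ) : Type :=
  Pentagon × (Fin (n - 2) → (Set.Icc (-1 : ℝ) 1))

/-- The standard basis vector `e_{k+1}` of `𝔽₂ⁿ` (indexed from `0`). -/
def eVec (n k : ℕ) : Fin n → ZMod 2 := fun i => if (i : ℕ) = k then 1 else 0

/-- The values of `χ'` on the five edge facets `E₁ × I^{n−2}, …, E₅ × I^{n−2}`: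
`e_{n−1}, e_n, e_{n−1}, e_n, e₁+⋯+e_n` in cyclic order. -/
def pentEdgeVal (n : ℕ) : Fin 5 → (Fin n → ZMod 2) :=
  ![eVec n (n - 2), eVec n (n - 1), eVec n (n - 2), eVec n (n - 1), fun _ => 1]

/-- The set of values `χ'(F)` over all facets `F` of `P₅ × I^{n−2}` containing the point
`p`: the cube facet in the `i`-th cube coordinate (value `e_i`) and the edge facets
(values `pentEdgeVal`). -/
noncomputable def pentGenSet (n : ℕ) (p : PentPrismPt n) : Set (Fin n → ZMod 2) :=
  {v | (∃ i : Fin (n - 2), ((p.2 i : ℝ) = -1 ∨ (p.2 i : ℝ) = 1) ∧ v = eVec n (i : ℕ)) ∨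
       (∃ k : Fin 5, (p.1 : ℂ) ∈ segment ℝ (pentVertex (k : ℕ)) (pentVertex ((k : ℕ) + 1)) ∧
          v = pentEdgeVal n k)}

/-- The small cover relation on `𝔽₂ⁿ × (P₅ × I^{n−2})`: `(t,p) ~ (u,q)` iff `p = q` and
`t + u` lies in the subgroup of `𝔽₂ⁿ` generated by the `χ'`-values of the facets
containing `p`. -/
noncomputable def pentCoverRel (n : ℕ)
    (x y : (Fin n → ZMod 2) × PentPrismPt n) : Prop :=
  x.2 = y.2 ∧ x.1 + y.1 ∈ Submodule.span (ZMod 2) (pentGenSet n x.2)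

/-- The small cover `X(P₅ × I^{n−2}, χ')`. -/
noncomputable def PentCover (n : ℕ) : Type := Quot (pentCoverRel n)

noncomputable instance (n : ℕ) : TopologicalSpace (PentCover n) := by
  unfold PentCover; infer_instance

/-- The `i`-th singular homology of a topological space with rational coefficients. -/
noncomputable def singularHomologyQ (X : TopCat.{0}) (i : ℕ) : ModuleCat.{0} ℚ :=
  ((AlgebraicTopology.alternatingFaceMapComplex (ModuleCat.{0} ℚ)).obj
    (((SimplicialObject.whiskering _ _).obj (ModuleCat.free ℚ)).obj
      (TopCat.toSSet.obj X))).homology i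

/-- The `i`-th rational Betti number `β_i(X; ℚ)`, as a cardinal. -/
noncomputable def rationalBetti (X : TopCat.{0}) (i : ℕ) : Cardinal :=
  Module.rank ℚ (singularHomologyQ X i)

/-- Binomial coefficient `C(a, b)` with an integer lower argument (zero when `b < 0`). -/
def chooseInt (a : ℕ) (b : ℤ) : ℕ := if 0 ≤ b then a.choose b.toNat else 0


open Complex CategoryTheory

noncomputable section

namespace PC

/-- the standard simplex with `k` vertices -/
abbrev E (k : ℕ) : Type := stdSimplex ℝ (Fin k)

/-- affine map with prescribed vertices -/
def aff {k m : ℕ} (v : Fin k → E m) : C(E k, E m) where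
  toFun x := ⟨fun i => ∑ j, x.1 j * (v j).1 i,
    fun i => Finset.sum_nonneg fun j _ => mul_nonneg (x.2.1 j) ((v j).2.1 i), by
      rw [Finset.sum_comm]
      simp_rw [← Finset.mul_sum, (v _).2.2, mul_one]
      exact x.2.2⟩
  continuous_toFun := by
    refine Continuous.subtype_mk ?_ _
    refine continuous_pi fun i => continuous_finsetSum _ fun j _ => ?_
    exact ((continuous_apply j).comp continuous_subtype_val).mul continuous_const

theorem aff_apply {k m : ℕ} (v : Fin k → E m) (x : E k) (i : Fin m) :
    (aff v x).1 i = ∑ j, x.1 j * (v j).1 i := rfl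

/-- vertices of the standard simplex -/
def vert (k : ℕ) (j : Fin k) : E k := ⟨Pi.single j 1, single_mem_stdSimplex ℝ j⟩

theorem aff_vert {k m : ℕ} (v : Fin k → E m) : aff v ∘ vert k = v := by
  funext j
  apply Subtype.ext
  funext i
  simp [aff_apply, vert, Pi.single_apply]

theorem aff_of_vert {k : ℕ} : aff (vert k) = ContinuousMap.id _ := by
  refine ContinuousMap.ext fun x => Subtype.ext (funext fun i => ?_)
  simp [aff_apply, vert, Pi.single_apply]

theorem aff_comp {k l m : ℕ} (v : Fin l → E m) (w : Fin k → E l) :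
    (aff v).comp (aff w) = aff (aff v ∘ w) := by
  refine ContinuousMap.ext fun x => Subtype.ext (funext fun i => ?_)
  simp only [ContinuousMap.comp_apply, aff_apply, Function.comp, Finset.sum_mul, Finset.mul_sum]
  rw [Finset.sum_comm]
  refine Finset.sum_congr rfl fun j _ => Finset.sum_congr rfl fun l _ => by ring

/-- uniform point -/
def unif (k : ℕ) : E (k + 1) := ⟨fun _ => 1 / (k + 1 : ℝ), fun _ => by positivity, by
  simp; field_simp⟩

def bary {k m : ℕ} (v : Fin (k + 1) → E m) : E m := aff v (unif k)

theorem bary_comp {k l m : ℕ} (v : Fin l → E m) (w : Fin (k + 1) → E l) :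
    bary (aff v ∘ w) = aff v (bary w) := by
  simp only [bary, ← aff_comp]; rfl

/-- augmented linear chains -/
abbrev LC (m : ℕ) : Type := (Σ k : ℕ, (Fin k → E m)) →₀ ℚ

/-- basis element -/
abbrev bs {m : ℕ} {k : ℕ} (v : Fin k → E m) : LC m := Finsupp.single ⟨k, v⟩ 1

def dV {m : ℕ} : (Σ k : ℕ, (Fin k → E m)) → LC m
  | ⟨0, _⟩ => 0
  | ⟨k + 1, v⟩ => ∑ j : Fin (k + 1), (-1 : ℚ) ^ (j : ℕ) • bs (v ∘ j.succAbove)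

def dL {m : ℕ} : LC m →ₗ[ℚ] LC m := Finsupp.linearCombination ℚ dV

def cone {m : ℕ} (b : E m) : LC m →ₗ[ℚ] LC m :=
  Finsupp.linearCombination ℚ fun s => bs (Fin.cons b s.2 : Fin (s.1 + 1) → E m)

theorem cone_bs {m k : ℕ} (b : E m) (v : Fin k → E m) :
    cone b (bs v) = bs (Fin.cons b v : Fin (k + 1) → E m) := by
  simp [cone]

theorem dL_zero {m : ℕ} (v : Fin 0 → E m) : dL (bs v) = 0 := by
  simp [dL, dV]

theorem dL_bs {m k : ℕ} (v : Fin (k + 1) → E m) :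
    dL (bs v) = ∑ j : Fin (k + 1), (-1 : ℚ) ^ (j : ℕ) • bs (v ∘ j.succAbove) := by
  simp [dL, dV]

/-- induction for linear identities -/
theorem LC_ext {m : ℕ} {N : Type*} [AddCommGroup N] [Module ℚ N] {f g : LC m →ₗ[ℚ] N}
    (h : ∀ k (v : Fin k → E m), f (bs v) = g (bs v)) (x : LC m) : f x = g x := by
  have : f = g := by
    apply Finsupp.lhom_ext'
    rintro ⟨k, v⟩
    apply LinearMap.ext_ring
    exact h k v
  rw [this]

theorem d_cone {m : ℕ} (b : E m) (x : LC m) : dL (cone b x) = x - cone b (dL x) := by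
  suffices h : (dL ∘ₗ cone b) x = (LinearMap.id - cone b ∘ₗ dL : LC m →ₗ[ℚ] LC m) x from h
  refine LC_ext (fun k v => ?_) x
  simp only [LinearMap.comp_apply, LinearMap.sub_apply, LinearMap.id_apply, cone_bs]
  rw [dL_bs, Fin.sum_univ_succ]
  have h0 : (Fin.cons b v : Fin (k + 1) → E m) ∘ (0 : Fin (k + 1)).succAbove = v := by
    funext i; simp
  rw [h0]
  cases k with
  | zero => simp [dL_zero]
  | succ k =>
    rw [dL_bs, map_sum, sub_eq_add_neg, ← Finset.sum_neg_distrib]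
    simp only [Fin.val_zero, pow_zero, one_smul]
    congr 1
    refine Finset.sum_congr rfl fun j _ => ?_
    rw [map_smul, cone_bs, Fin.val_succ, pow_succ, mul_neg_one, neg_smul]
    congr 3
    funext i
    refine Fin.cases ?_ (fun i => ?_) i
    · simp
    · simp [Fin.succ_succAbove_succ]

theorem bs_eq_cone {m k : ℕ} (v : Fin (k + 1) → E m) :
    bs v = cone (v 0) (bs (Fin.tail v)) := by
  rw [cone_bs, Fin.cons_self_tail]

theorem dL_dL {m : ℕ} (x : LC m) : dL (dL x) = 0 := by
  suffices h : (dL ∘ₗ dL) x = (0 : LC m →ₗ[ℚ] LC m) x from h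
  refine LC_ext (fun k => ?_) x
  induction k with
  | zero => intro v; simp [dL_zero]
  | succ k ih =>
    intro v
    have := ih (Fin.tail v)
    simp only [LinearMap.comp_apply, LinearMap.zero_apply] at this ⊢
    rw [bs_eq_cone, d_cone, map_sub, d_cone, this]
    simp

/-- pushforward -/
def push {m m' : ℕ} (f : E m → E m') : LC m →ₗ[ℚ] LC m' :=
  Finsupp.linearCombination ℚ fun s => bs (f ∘ s.2)

theorem push_bs {m m' k : ℕ} (f : E m → E m') (v : Fin k → E m) :
    push f (bs v) = bs (f ∘ v) := by simp [push]

theorem push_cone {m m' : ℕ} (f : E m → E m') (b : E m) (x : LC m) :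
    push f (cone b x) = cone (f b) (push f x) := by
  suffices h : (push f ∘ₗ cone b) x = (cone (f b) ∘ₗ push f) x from h
  refine LC_ext (fun k v => ?_) x
  simp only [LinearMap.comp_apply, cone_bs, push_bs]
  refine congrArg (fun z => bs z) ?_
  funext i
  refine Fin.cases ?_ (fun i => ?_) i <;> simp

theorem push_d {m m' : ℕ} (f : E m → E m') (x : LC m) :
    push f (dL x) = dL (push f x) := by
  suffices h : (push f ∘ₗ dL) x = (dL ∘ₗ push f) x from h
  refine LC_ext (fun k v => ?_) x
  simp only [LinearMap.comp_apply, push_bs]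
  cases k with
  | zero => simp [dL_zero]
  | succ k =>
    rw [dL_bs, dL_bs, map_sum]
    simp only [map_smul, push_bs]
    rfl

/-- subdivision -/
def sdV {m : ℕ} : (k : ℕ) → (Fin k → E m) → LC m
  | 0, v => bs v
  | k + 1, v => cone (bary v) (∑ j : Fin (k + 1), (-1 : ℚ) ^ (j : ℕ) • sdV k (v ∘ j.succAbove))

def sdL {m : ℕ} : LC m →ₗ[ℚ] LC m := Finsupp.linearCombination ℚ fun s => sdV s.1 s.2

theorem sdL_zero {m : ℕ} (v : Fin 0 → E m) : sdL (bs v) = bs v := by simp [sdL, sdV]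

theorem sdL_succ {m k : ℕ} (v : Fin (k + 1) → E m) :
    sdL (bs v) = cone (bary v) (sdL (dL (bs v))) := by
  rw [dL_bs, map_sum]
  simp [sdL, sdV]

/-- homotopy -/
def tV {m : ℕ} : (k : ℕ) → (Fin k → E m) → LC m
  | 0, _ => 0
  | k + 1, v => cone (bary v)
      (bs v - ∑ j : Fin (k + 1), (-1 : ℚ) ^ (j : ℕ) • tV k (v ∘ j.succAbove))

def tL {m : ℕ} : LC m →ₗ[ℚ] LC m := Finsupp.linearCombination ℚ fun s => tV s.1 s.2

theorem tL_zero {m : ℕ} (v : Fin 0 → E m) : tL (bs v) = 0 := by simp [tL, tV]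

theorem tL_succ {m k : ℕ} (v : Fin (k + 1) → E m) :
    tL (bs v) = cone (bary v) (bs v - tL (dL (bs v))) := by
  rw [dL_bs, map_sum]
  simp [tL, tV]

/-- If two operators agree on simplices with `k` vertices they agree on boundaries -/
theorem agree_d {m k : ℕ} {N : Type*} [AddCommGroup N] [Module ℚ N] {f g : LC m →ₗ[ℚ] N}
    (h : ∀ (v : Fin k → E m), f (bs v) = g (bs v)) (v : Fin (k + 1) → E m) :
    f (dL (bs v)) = g (dL (bs v)) := by
  rw [dL_bs, map_sum, map_sum]
  exact Finset.sum_congr rfl fun j _ => by rw [map_smul, map_smul, h]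

theorem d_sd {m : ℕ} (x : LC m) : dL (sdL x) = sdL (dL x) := by
  suffices h : (dL ∘ₗ sdL) x = (sdL ∘ₗ dL) x from h
  refine LC_ext (fun k => ?_) x
  induction k with
  | zero => intro v; simp [dL_zero, sdL_zero]
  | succ k ih =>
    intro v
    have := agree_d ih v
    simp only [LinearMap.comp_apply] at this ⊢
    rw [sdL_succ, d_cone, this, dL_dL]
    simp

theorem dt_td {m : ℕ} (x : LC m) : dL (tL x) + tL (dL x) = x - sdL x := by
  suffices h : (dL ∘ₗ tL + tL ∘ₗ dL : LC m →ₗ[ℚ] LC m) x = (LinearMap.id - sdL : LC m →ₗ[ℚ] LC m) x from h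
  refine LC_ext (fun k => ?_) x
  induction k with
  | zero => intro v; simp [dL_zero, sdL_zero, tL_zero]
  | succ k ih =>
    intro v
    have := agree_d ih v
    simp only [LinearMap.comp_apply, LinearMap.add_apply, LinearMap.sub_apply,
      LinearMap.id_apply, dL_dL, map_zero, add_zero] at this ⊢
    rw [tL_succ, d_cone, map_sub dL, this, sdL_succ v]
    simp only [sub_sub_cancel]
    abel

theorem push_sd {m m' : ℕ} (u : Fin m → E m') (x : LC m) :
    push (aff u) (sdL x) = sdL (push (aff u) x) := by
  suffices h : (push (aff u) ∘ₗ sdL) x = (sdL ∘ₗ push (aff u)) x from h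
  refine LC_ext (fun k => ?_) x
  induction k with
  | zero => intro v; simp [push_bs, sdL_zero]
  | succ k ih =>
    intro v
    have := agree_d ih v
    simp only [LinearMap.comp_apply] at this ⊢
    rw [sdL_succ, push_cone, this, push_bs, sdL_succ, bary_comp, push_d, push_bs]

theorem push_t {m m' : ℕ} (u : Fin m → E m') (x : LC m) :
    push (aff u) (tL x) = tL (push (aff u) x) := by
  suffices h : (push (aff u) ∘ₗ tL) x = (tL ∘ₗ push (aff u)) x from h
  refine LC_ext (fun k => ?_) x
  induction k with
  | zero => intro v; simp [push_bs, tL_zero]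
  | succ k ih =>
    intro v
    have := agree_d ih v
    simp only [LinearMap.comp_apply] at this ⊢
    rw [tL_succ, push_cone, map_sub, this, push_bs, tL_succ, bary_comp, push_d, push_bs]

end PC
end

open Complex CategoryTheory

noncomputable section

namespace PC

variable {X : Type} [TopologicalSpace X]

/-- singular simplices -/
abbrev Sg (X : Type) [TopologicalSpace X] : Type := Σ k : ℕ, C(E (k + 1), X)

/-- singular chains (all degrees together) -/
abbrev Ch (X : Type) [TopologicalSpace X] : Type := Sg X →₀ ℚ

abbrev sg {k : ℕ} (σ : C(E (k + 1), X)) : Ch X := Finsupp.single ⟨k, σ⟩ 1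

theorem Ch_ext {N : Type*} [AddCommGroup N] [Module ℚ N] {f g : Ch X →ₗ[ℚ] N}
    (h : ∀ k (σ : C(E (k + 1), X)), f (sg σ) = g (sg σ)) (x : Ch X) : f x = g x := by
  have : f = g := by
    apply Finsupp.lhom_ext'
    rintro ⟨k, v⟩
    apply LinearMap.ext_ring
    exact h k v
  rw [this]

def realV {m : ℕ} (f : C(E m, X)) : (Σ k : ℕ, (Fin k → E m)) → Ch X
  | ⟨0, _⟩ => 0
  | ⟨_ + 1, v⟩ => sg (f.comp (aff v))

/-- realization of linear chains -/
def real {m : ℕ} (f : C(E m, X)) : LC m →ₗ[ℚ] Ch X := Finsupp.linearCombination ℚ (realV f)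

theorem real_zero {m : ℕ} (f : C(E m, X)) (v : Fin 0 → E m) : real f (bs v) = 0 := by
  simp [real, realV]

theorem real_bs {m k : ℕ} (f : C(E m, X)) (v : Fin (k + 1) → E m) :
    real f (bs v) = sg (f.comp (aff v)) := by
  simp [real, realV]

theorem real_comp {m l : ℕ} (f : C(E m, X)) (v : Fin l → E m) (y : LC l) :
    real (f.comp (aff v)) y = real f (push (aff v) y) := by
  suffices h : real (f.comp (aff v)) y = (real f ∘ₗ push (aff v)) y from h
  refine LC_ext (fun k w => ?_) y
  simp only [LinearMap.comp_apply, push_bs]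
  cases k with
  | zero => simp [real_zero]
  | succ k => rw [real_bs, real_bs, ContinuousMap.comp_assoc, aff_comp]

theorem real_vert {k : ℕ} (f : C(E (k + 1), X)) : real f (bs (vert (k + 1))) = sg f := by
  rw [real_bs, aff_of_vert, ContinuousMap.comp_id]

/-- singular operator attached to a linear one -/
def op (Φ : ∀ m, LC m →ₗ[ℚ] LC m) : Ch X →ₗ[ℚ] Ch X :=
  Finsupp.linearCombination ℚ fun s => real s.2 (Φ (s.1 + 1) (bs (vert (s.1 + 1))))

theorem op_sg (Φ : ∀ m, LC m →ₗ[ℚ] LC m) {k : ℕ} (σ : C(E (k + 1), X)) :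
    op Φ (sg σ) = real σ (Φ (k + 1) (bs (vert (k + 1)))) := by simp [op]

theorem op_real (Φ : ∀ m, LC m →ₗ[ℚ] LC m)
    (h0 : ∀ m (v : Fin 0 → E m), ∃ c : ℚ, Φ m (bs v) = c • bs v)
    (hn : ∀ m m' (u : Fin m → E m') x, push (aff u) (Φ m x) = Φ m' (push (aff u) x))
    {m : ℕ} (f : C(E m, X)) (y : LC m) : op Φ (real f y) = real f (Φ m y) := by
  suffices h : (op Φ ∘ₗ real f) y = (real f ∘ₗ Φ m) y from h
  refine LC_ext (fun k w => ?_) y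
  simp only [LinearMap.comp_apply]
  cases k with
  | zero =>
    obtain ⟨c, hc⟩ := h0 m w
    rw [hc, map_smul, real_zero]; simp
  | succ k =>
    rw [real_bs, op_sg, real_comp, hn, push_bs, aff_vert]

/-- the singular differential -/
def dM : Ch X →ₗ[ℚ] Ch X := op fun _ => dL
def sdM : Ch X →ₗ[ℚ] Ch X := op fun _ => sdL
def tM : Ch X →ₗ[ℚ] Ch X := op fun _ => tL

theorem dM_real {m : ℕ} (f : C(E m, X)) (y : LC m) : dM (real f y) = real f (dL y) :=
  op_real _ (fun _ v => ⟨0, by rw [dL_zero, zero_smul]⟩) (fun _ _ _ _ => push_d _ _) f y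
theorem sdM_real {m : ℕ} (f : C(E m, X)) (y : LC m) : sdM (real f y) = real f (sdL y) :=
  op_real _ (fun _ v => ⟨1, by rw [sdL_zero, one_smul]⟩) (fun _ _ _ _ => push_sd _ _) f y
theorem tM_real {m : ℕ} (f : C(E m, X)) (y : LC m) : tM (real f y) = real f (tL y) :=
  op_real _ (fun _ v => ⟨0, by rw [tL_zero, zero_smul]⟩) (fun _ _ _ _ => push_t _ _) f y

theorem dM_dM (x : Ch X) : dM (dM x) = 0 := by
  suffices h : (dM ∘ₗ dM) x = (0 : Ch X →ₗ[ℚ] Ch X) x from h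
  refine Ch_ext (fun k σ => ?_) x
  simp only [LinearMap.comp_apply, LinearMap.zero_apply]
  rw [← real_vert σ, dM_real, dM_real, dL_dL, map_zero]

theorem dtM (x : Ch X) : dM (tM x) + tM (dM x) = x - sdM x := by
  suffices h : (dM ∘ₗ tM + tM ∘ₗ dM : Ch X →ₗ[ℚ] Ch X) x =
    (LinearMap.id - sdM : Ch X →ₗ[ℚ] Ch X) x from h
  refine Ch_ext (fun k σ => ?_) x
  simp only [LinearMap.comp_apply, LinearMap.add_apply, LinearMap.sub_apply, LinearMap.id_apply]
  rw [← real_vert σ, dM_real, tM_real, tM_real, dM_real, sdM_real, ← map_add, dt_td, map_sub]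

theorem d_sdM (x : Ch X) : dM (sdM x) = sdM (dM x) := by
  suffices h : (dM ∘ₗ sdM) x = (sdM ∘ₗ dM) x from h
  refine Ch_ext (fun k σ => ?_) x
  simp only [LinearMap.comp_apply]
  rw [← real_vert σ, dM_real, sdM_real, sdM_real, dM_real, d_sd]

/-- chains supported in a set -/
def SC (U : Set X) : Submodule ℚ (Ch X) :=
  Finsupp.supported ℚ ℚ {s : Sg X | ∀ x, s.2 x ∈ U}

theorem sg_mem_SC {U : Set X} {k : ℕ} {σ : C(E (k + 1), X)} (h : ∀ x, σ x ∈ U) :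
    sg σ ∈ SC U := Finsupp.single_mem_supported ℚ 1 h

theorem SC_inter (U V : Set X) : SC (U ∩ V) = SC U ⊓ SC V := by
  rw [SC, SC, SC, ← Finsupp.supported_inter]
  congr 1
  ext s
  simp [forall_and]

theorem SC_mono {U V : Set X} (h : U ⊆ V) : SC U ≤ SC V :=
  Finsupp.supported_mono fun _ hs x => h (hs x)

theorem SC_induct {U : Set X} {N : Submodule ℚ (Ch X)}
    (h : ∀ k (σ : C(E (k + 1), X)), (∀ x, σ x ∈ U) → sg σ ∈ N) : SC U ≤ N := by
  rw [SC, Finsupp.supported_eq_span_single, Submodule.span_le]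
  rintro _ ⟨⟨k, σ⟩, hs, rfl⟩
  exact h k σ hs

theorem real_mem_SC {U : Set X} {m : ℕ} {f : C(E m, X)} (h : ∀ x, f x ∈ U) (y : LC m) :
    real f y ∈ SC U := by
  have : LinearMap.range (real f) ≤ SC U := by
    rw [real, Finsupp.range_linearCombination, Submodule.span_le]
    rintro _ ⟨⟨k, v⟩, rfl⟩
    cases k with
    | zero => exact (SC U).zero_mem
    | succ k => exact sg_mem_SC fun x => h _
  exact this ⟨y, rfl⟩

theorem op_mem_SC (Φ : ∀ m, LC m →ₗ[ℚ] LC m) {U : Set X} {x : Ch X} (hx : x ∈ SC U) :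
    op Φ x ∈ SC U := by
  have : SC U ≤ (SC U).comap (op Φ) := SC_induct fun k σ h => by
    rw [Submodule.mem_comap, op_sg]
    exact real_mem_SC h _
  exact this hx

/-- pushforward of singular chains -/
def pM {Y : Type} [TopologicalSpace Y] (f : C(X, Y)) : Ch X →ₗ[ℚ] Ch Y :=
  Finsupp.linearCombination ℚ fun s => sg (f.comp s.2)

theorem pM_sg {Y : Type} [TopologicalSpace Y] (f : C(X, Y)) {k : ℕ} (σ : C(E (k + 1), X)) :
    pM f (sg σ) = sg (f.comp σ) := by simp [pM]

theorem pM_real {Y : Type} [TopologicalSpace Y] (f : C(X, Y)) {m : ℕ} (g : C(E m, X)) (y : LC m) :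
    pM f (real g y) = real (f.comp g) y := by
  suffices h : (pM f ∘ₗ real g) y = real (f.comp g) y from h
  refine LC_ext (fun k w => ?_) y
  simp only [LinearMap.comp_apply]
  cases k with
  | zero => simp [real_zero]
  | succ k => rw [real_bs, real_bs, pM_sg]; rfl

theorem pM_d {Y : Type} [TopologicalSpace Y] (f : C(X, Y)) (x : Ch X) :
    pM f (dM x) = dM (pM f x) := by
  suffices h : (pM f ∘ₗ dM) x = (dM ∘ₗ pM f) x from h
  refine Ch_ext (fun k σ => ?_) x
  simp only [LinearMap.comp_apply]
  rw [pM_sg, dM, op_sg, pM_real, dM, op_sg]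

/-! smallness -/

/-- l1 distance -/
def l1 {k : ℕ} (x y : E k) : ℝ := ∑ i, |x.1 i - y.1 i|

def Good {k : ℕ} (w : Fin (k + 1) → E (k + 1)) : Prop :=
  ∃ i0, ∀ j, 1 / (k + 1 : ℝ) ≤ (w j).1 i0

theorem Good.lip {k : ℕ} {w : Fin (k + 1) → E (k + 1)} (h : Good w) (x y : E (k + 1)) :
    l1 (aff w x) (aff w y) ≤ (1 - 1 / (k + 1 : ℝ)) * l1 x y := by
  obtain ⟨i0, h⟩ := h
  have key : ∀ i, |(aff w x).1 i - (aff w y).1 i| ≤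
      ∑ j, |x.1 j - y.1 j| * ((w j).1 i - if i = i0 then 1 / (k + 1 : ℝ) else 0) := by
    intro i
    have h1 : (aff w x).1 i - (aff w y).1 i =
        ∑ j, (x.1 j - y.1 j) * ((w j).1 i - if i = i0 then 1 / (k + 1 : ℝ) else 0) := by
      simp only [mul_sub, Finset.sum_sub_distrib, ← Finset.sum_mul, x.2.2, y.2.2, aff_apply,
        sub_mul]
      ring
    rw [h1]
    refine (Finset.abs_sum_le_sum_abs _ _).trans (Finset.sum_le_sum fun j _ => ?_)
    rw [abs_mul, abs_of_nonneg (a := (w j).1 i - _)]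
    split_ifs with hi
    · rw [hi]; linarith [h j]
    · simpa using (w j).2.1 i
  refine (Finset.sum_le_sum fun i _ => key i).trans (le_of_eq ?_)
  rw [Finset.sum_comm, l1, Finset.mul_sum]
  refine Finset.sum_congr rfl fun j _ => ?_
  rw [← Finset.mul_sum, Finset.sum_sub_distrib, (w j).2.2]
  simp
  ring

def GoodS (k : ℕ) : Submodule ℚ (LC (k + 1)) :=
  Submodule.span ℚ {y | ∃ w : Fin (k + 1) → E (k + 1), Good w ∧ y = bs w}

theorem sd_good (k : ℕ) : sdL (bs (vert (k + 1))) ∈ GoodS k := by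
  have hb : ∀ k : ℕ, bary (vert (k + 1)) = unif k := fun k => by
    rw [bary, aff_of_vert]; rfl
  induction k with
  | zero =>
    rw [sdL_succ, dL_bs, map_sum, map_sum]
    refine Submodule.sum_mem _ fun j _ => ?_
    rw [map_smul, map_smul, sdL_zero, cone_bs]
    refine Submodule.smul_mem _ _ (Submodule.subset_span ⟨_, ⟨0, fun j => ?_⟩, rfl⟩)
    have : j = 0 := Fin.ext (by omega)
    subst this
    simp [hb, unif]
  | succ k ih =>
    rw [sdL_succ, dL_bs, map_sum, map_sum]
    refine Submodule.sum_mem _ fun j _ => ?_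
    rw [map_smul, map_smul]
    refine Submodule.smul_mem _ _ ?_
    rw [← aff_vert (vert (k + 1 + 1) ∘ j.succAbove), ← push_bs, ← push_sd]
    have : GoodS k ≤ (GoodS (k + 1)).comap
        (cone (bary (vert (k + 1 + 1))) ∘ₗ push (aff (vert (k + 1 + 1) ∘ j.succAbove))) := by
      rw [GoodS, Submodule.span_le]
      rintro _ ⟨w, ⟨i0, hw⟩, rfl⟩
      rw [SetLike.mem_coe, Submodule.mem_comap, LinearMap.comp_apply, push_bs, cone_bs]
      refine Submodule.subset_span ⟨_, ⟨j.succAbove i0, fun l => ?_⟩, rfl⟩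
      refine Fin.cases ?_ (fun l => ?_) l
      · simp [hb, unif]
      · simp only [Fin.cons_succ, Function.comp, aff_apply]
        rw [Finset.sum_eq_single i0]
        · simp only [vert, Pi.single_eq_same, mul_one]
          refine le_trans ?_ (hw l)
          push_cast
          apply one_div_le_one_div_of_le <;> linarith [(Nat.cast_nonneg k : (0:ℝ) ≤ k)]
        · intro b _ hb
          simp [vert, Pi.single_apply, hb.symm]
        · simp
    exact this ih

/-- iterated subdivision lands in contracted simplices -/
def ContrS {k : ℕ} (σ : C(E (k + 1), X)) (N : ℕ) : Submodule ℚ (Ch X) :=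
  Submodule.span ℚ {y | ∃ α : C(E (k + 1), E (k + 1)),
    (∀ p q, l1 (α p) (α q) ≤ (1 - 1 / (k + 1 : ℝ)) ^ N * l1 p q) ∧ y = sg (σ.comp α)}

theorem sd_iter {k : ℕ} (σ : C(E (k + 1), X)) (N : ℕ) : (sdM^[N]) (sg σ) ∈ ContrS σ N := by
  induction N with
  | zero => exact Submodule.subset_span ⟨ContinuousMap.id _, by simp, by simp⟩
  | succ N ih =>
    rw [Function.iterate_succ_apply']
    have : ContrS σ N ≤ (ContrS σ (N + 1)).comap sdM := by
      rw [ContrS, Submodule.span_le]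
      rintro _ ⟨α, hα, rfl⟩
      rw [SetLike.mem_coe, Submodule.mem_comap, sdM, op_sg]
      have h2 : GoodS k ≤ (ContrS σ (N + 1)).comap (real (σ.comp α)) := by
        rw [GoodS, Submodule.span_le]
        rintro _ ⟨w, hw, rfl⟩
        rw [SetLike.mem_coe, Submodule.mem_comap, real_bs]
        refine Submodule.subset_span ⟨α.comp (aff w), fun p q => ?_, rfl⟩
        refine (hα _ _).trans ?_
        rw [pow_succ, mul_assoc]
        refine mul_le_mul_of_nonneg_left (hw.lip p q) (pow_nonneg ?_ _)
        rw [sub_nonneg, div_le_one (by positivity)]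
        linarith [(Nat.cast_nonneg k : (0:ℝ) ≤ k)]
      exact h2 (sd_good k)
    exact this ih

theorem l1_le {k : ℕ} (x y : E k) : l1 x y ≤ 2 := by
  have : l1 x y ≤ ∑ i, (x.1 i + y.1 i) := Finset.sum_le_sum fun i _ => by
    rw [abs_le]; constructor <;> linarith [x.2.1 i, y.2.1 i]
  rw [Finset.sum_add_distrib, x.2.2, y.2.2] at this
  linarith

theorem dist_le_l1 {k : ℕ} (x y : E k) : dist x y ≤ l1 x y := by
  rw [Subtype.dist_eq]
  refine (dist_pi_le_iff (show 0 ≤ l1 x y from Finset.sum_nonneg fun _ _ => abs_nonneg _)).2 ?_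
  intro i
  rw [Real.dist_eq]
  exact Finset.single_le_sum (f := fun i => |x.1 i - y.1 i|) (fun _ _ => abs_nonneg _)
    (Finset.mem_univ i)

theorem small_sg {U V : Set X} (hU : IsOpen U) (hV : IsOpen V) {k : ℕ} (σ : C(E (k + 1), X))
    (h : ∀ x, σ x ∈ U ∪ V) : ∃ N, (sdM^[N]) (sg σ) ∈ SC U ⊔ SC V := by
  obtain ⟨δ, hδ, H⟩ := lebesgue_number_lemma_of_metric (s := (Set.univ : Set (E (k + 1))))
    (c := fun b : Bool => σ ⁻¹' (if b then U else V)) isCompact_univ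
    (fun b => by cases b <;> simp [hU.preimage σ.continuous, hV.preimage σ.continuous])
    (fun x _ => by
      rcases h x with h | h
      · exact Set.mem_iUnion.2 ⟨true, by simpa using h⟩
      · exact Set.mem_iUnion.2 ⟨false, by simpa using h⟩)
  have hr : |1 - 1 / (k + 1 : ℝ)| < 1 := by
    rw [abs_lt]
    have h1 : 0 < 1 / (k + 1 : ℝ) := by positivity
    have h2 : 1 / (k + 1 : ℝ) ≤ 1 := by
      rw [div_le_one (by positivity)]; linarith [(Nat.cast_nonneg k : (0:ℝ) ≤ k)]
    constructor <;> linarith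
  obtain ⟨N, hN⟩ := (((tendsto_pow_atTop_nhds_zero_of_abs_lt_one hr).mul_const 2).eventually
    (gt_mem_nhds (by simpa using hδ))).exists
  refine ⟨N, ?_⟩
  have : ContrS σ N ≤ SC U ⊔ SC V := by
    rw [ContrS, Submodule.span_le]
    rintro _ ⟨α, hα, rfl⟩
    obtain ⟨b, hb⟩ := H (α (unif k)) (Set.mem_univ _)
    have : ∀ x, σ (α x) ∈ (if b then U else V) := fun x => by
      apply hb
      rw [Metric.mem_ball]
      refine lt_of_le_of_lt ((dist_le_l1 _ _).trans (hα _ _)) (lt_of_le_of_lt ?_ hN)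
      refine mul_le_mul_of_nonneg_left (l1_le _ _) (pow_nonneg ?_ _)
      rw [sub_nonneg, div_le_one (by positivity)]
      linarith [(Nat.cast_nonneg k : (0:ℝ) ≤ k)]
    cases b
    · exact Submodule.mem_sup_right (sg_mem_SC fun x => by simpa using this x)
    · exact Submodule.mem_sup_left (sg_mem_SC fun x => by simpa using this x)
  exact this (sd_iter σ N)

theorem sd_mem_sup {U V : Set X} {x : Ch X} (hx : x ∈ SC U ⊔ SC V) : sdM x ∈ SC U ⊔ SC V := by
  obtain ⟨u, hu, v, hv, rfl⟩ := Submodule.mem_sup.1 hx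
  rw [map_add]
  exact Submodule.add_mem_sup (op_mem_SC _ hu) (op_mem_SC _ hv)

theorem t_mem_sup {U V : Set X} {x : Ch X} (hx : x ∈ SC U ⊔ SC V) : tM x ∈ SC U ⊔ SC V := by
  obtain ⟨u, hu, v, hv, rfl⟩ := Submodule.mem_sup.1 hx
  rw [map_add]
  exact Submodule.add_mem_sup (op_mem_SC _ hu) (op_mem_SC _ hv)

theorem small_ex {U V : Set X} (hU : IsOpen U) (hV : IsOpen V) {x : Ch X} (hx : x ∈ SC (U ∪ V)) :
    ∃ N, ((sdM : Ch X →ₗ[ℚ] Ch X) ^ N) x ∈ SC U ⊔ SC V := by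
  have hmono : ∀ (y : Ch X) N N', N ≤ N' → ((sdM : Ch X →ₗ[ℚ] Ch X) ^ N) y ∈ SC U ⊔ SC V →
      ((sdM : Ch X →ₗ[ℚ] Ch X) ^ N') y ∈ SC U ⊔ SC V := by
    intro y N N' hle h
    induction hle with
    | refl => exact h
    | step _ ih => rw [pow_succ']; exact sd_mem_sup ih
  let S : Submodule ℚ (Ch X) :=
    { carrier := {x | ∃ N, ((sdM : Ch X →ₗ[ℚ] Ch X) ^ N) x ∈ SC U ⊔ SC V}
      zero_mem' := ⟨0, by simp⟩
      add_mem' := by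
        rintro a b ⟨N, hN⟩ ⟨N', hN'⟩
        refine ⟨max N N', ?_⟩
        rw [map_add]
        exact Submodule.add_mem _ (hmono _ _ _ (le_max_left _ _) hN)
          (hmono _ _ _ (le_max_right _ _) hN')
      smul_mem' := by
        rintro c a ⟨N, hN⟩
        exact ⟨N, by rw [map_smul]; exact Submodule.smul_mem _ _ hN⟩ }
  have : SC (U ∪ V) ≤ S := SC_induct fun k σ h => by
    obtain ⟨N, hN⟩ := small_sg hU hV σ h
    exact ⟨N, by rw [Module.End.pow_apply]; exact hN⟩
  exact this hx

/-- small chains theorem -/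
theorem small_thm {U V : Set X} (hU : IsOpen U) (hV : IsOpen V) {x : Ch X} (hx : x ∈ SC (U ∪ V))
    (hdx : dM x ∈ SC U ⊔ SC V) : ∃ y ∈ SC (U ∪ V), x - dM y ∈ SC U ⊔ SC V := by
  obtain ⟨N, hN⟩ := small_ex hU hV hx
  induction N generalizing x with
  | zero => exact ⟨0, Submodule.zero_mem _, by simpa using hN⟩
  | succ N ih =>
    have h1 : sdM x ∈ SC (U ∪ V) := op_mem_SC _ hx
    obtain ⟨y, hy, hxy⟩ := ih h1 (by rw [d_sdM]; exact sd_mem_sup hdx)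
      (by rw [pow_succ] at hN; exact hN)
    refine ⟨y + tM x, Submodule.add_mem _ hy (op_mem_SC _ hx), ?_⟩
    have : x - dM (y + tM x) = (sdM x - dM y) + tM (dM x) := by
      have h2 : sdM x = x - (dM (tM x) + tM (dM x)) := by rw [dtM]; abel
      rw [map_add, h2]; abel
    rw [this]
    exact Submodule.add_mem _ hxy (t_mem_sup hdx)

end PC
end

open Complex CategoryTheory

noncomputable section

namespace PC

variable {X : Type} [TopologicalSpace X]

theorem dM_sg {k : ℕ} (σ : C(E (k + 1 + 1), X)) :
    dM (sg σ) = ∑ j : Fin (k + 1 + 1),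
      (-1 : ℚ) ^ (j : ℕ) • sg (σ.comp (aff (vert (k + 1 + 1) ∘ j.succAbove))) := by
  rw [dM, op_sg, dL_bs, map_sum]
  exact Finset.sum_congr rfl fun j _ => by rw [map_smul, real_bs]

theorem dM_sg0 (σ : C(E (0 + 1), X)) : dM (sg σ) = 0 := by
  rw [dM, op_sg, dL_bs, map_sum]
  exact Finset.sum_eq_zero fun j _ => by rw [map_smul, real_zero, smul_zero]

/-- projection to degree `k` -/
def pr (k : ℕ) : Ch X →ₗ[ℚ] Ch X :=
  Finsupp.linearCombination ℚ fun s => if s.1 = k then Finsupp.single s 1 else 0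

theorem pr_sg {k j : ℕ} (σ : C(E (j + 1), X)) :
    pr k (sg σ) = if j = k then sg σ else 0 := by simp [pr]

theorem d_pr (k : ℕ) (x : Ch X) : dM (pr (k + 1) x) = pr k (dM x) := by
  suffices h : (dM ∘ₗ pr (k + 1)) x = (pr k ∘ₗ dM) x from h
  refine Ch_ext (fun j σ => ?_) x
  simp only [LinearMap.comp_apply, pr_sg]
  cases j with
  | zero => simp [dM_sg0]
  | succ j =>
    rw [dM_sg, map_sum]
    simp only [map_smul, pr_sg, add_left_inj]
    split_ifs with h
    · rw [dM_sg]
    · simp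

theorem pr_mem_SC {U : Set X} {x : Ch X} (k : ℕ) (hx : x ∈ SC U) : pr k x ∈ SC U := by
  have : SC U ≤ (SC U).comap (pr k) := SC_induct fun k σ h => by
    rw [Submodule.mem_comap, pr_sg]
    split_ifs
    · exact sg_mem_SC h
    · exact Submodule.zero_mem _
  exact this hx

theorem pr_pM (f : C(X, X)) (k : ℕ) (x : Ch X) : pr k (pM f x) = pM f (pr k x) := by
  suffices h : (pr k ∘ₗ pM f) x = (pM f ∘ₗ pr k) x from h
  refine Ch_ext (fun j σ => ?_) x
  simp only [LinearMap.comp_apply, pr_sg, pM_sg]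
  split_ifs <;> simp [pM_sg]

/-- d-stability -/
def St (A : Submodule ℚ (Ch X)) : Prop := (∀ x ∈ A, dM x ∈ A) ∧ ∀ k, ∀ x ∈ A, pr k x ∈ A

/-- relative acyclicity -/
def Acyc (B A : Submodule ℚ (Ch X)) : Prop :=
  ∀ x ∈ B, dM x ∈ A → ∃ y ∈ B, x - dM y ∈ A

def Sph (A : Submodule ℚ (Ch X)) (k : ℕ) : Prop :=
  ∃ z ∈ A, pr k z = z ∧ dM z = 0 ∧ (∀ x ∈ A, dM x = 0 → ∃ y ∈ A, ∃ c : ℚ, x = dM y + c • z) ∧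
    ∀ y ∈ A, dM y ≠ z

variable {A A' A1 A2 A1' A2' B Q R : Submodule ℚ (Ch X)}

theorem St.sup (h1 : St A1) (h2 : St A2) : St (A1 ⊔ A2) := by
  constructor
  · intro x hx
    obtain ⟨u, hu, v, hv, rfl⟩ := Submodule.mem_sup.1 hx
    rw [map_add]
    exact Submodule.add_mem_sup (h1.1 _ hu) (h2.1 _ hv)
  · intro k x hx
    obtain ⟨u, hu, v, hv, rfl⟩ := Submodule.mem_sup.1 hx
    rw [map_add]
    exact Submodule.add_mem_sup (h1.2 _ _ hu) (h2.2 _ _ hv)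

theorem Acyc.trans (hAB : A ≤ B) (hA' : A' ≤ A) (h1 : Acyc B A) (h2 : Acyc A A') : Acyc B A' := by
  intro x hx hdx
  obtain ⟨y, hy, hxy⟩ := h1 x hx (hA' hdx)
  obtain ⟨y', hy', hxy'⟩ := h2 _ hxy (by rw [map_sub, dM_dM, sub_zero]; exact hdx)
  exact ⟨y + y', B.add_mem hy (hAB hy'), by rw [map_add, ← sub_sub]; exact hxy'⟩

theorem Acyc.top (hQR : Q ≤ R) (hRB : R ≤ B) (h1 : Acyc B Q) (h2 : Acyc R Q) :
    Acyc B R := by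
  intro x hx hdx
  obtain ⟨r, hr, hq⟩ := h2 _ hdx (by rw [dM_dM]; exact Q.zero_mem)
  obtain ⟨y, hy, hxy⟩ := h1 (x - r) (B.sub_mem hx (hRB hr)) (by rw [map_sub]; exact hq)
  refine ⟨y, hy, ?_⟩
  have : x - dM y = (x - r - dM y) + r := by abel
  rw [this]
  exact R.add_mem (hQR hxy) hr

theorem Acyc.second (hs1 : St A1) (hs2 : St A2) (h : Acyc A1 (A1 ⊓ A2)) : Acyc (A1 ⊔ A2) A2 := by
  intro x hx hdx
  obtain ⟨a, ha, b, hb, rfl⟩ := Submodule.mem_sup.1 hx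
  rw [map_add] at hdx
  have h1 : dM a ∈ A2 := by
    have := A2.sub_mem hdx (hs2.1 _ hb)
    rwa [add_sub_cancel_right] at this
  obtain ⟨y, hy, hxy⟩ := h a ha ⟨hs1.1 _ ha, h1⟩
  refine ⟨y, Submodule.mem_sup_left hy, ?_⟩
  have : a + b - dM y = (a - dM y) + b := by abel
  rw [this]
  exact A2.add_mem hxy.2 hb

theorem Acyc.five (hs1 : St A1) (hs2 : St A2) (hs1' : St A1') (hs2' : St A2')
    (hl1 : A1' ≤ A1) (hl2 : A2' ≤ A2)
    (h1 : Acyc A1 A1') (h2 : Acyc A2 A2') (h12 : Acyc (A1 ⊓ A2) (A1' ⊓ A2')) :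
    Acyc (A1 ⊔ A2) (A1' ⊔ A2') := by
  intro x hx hdx
  obtain ⟨a1, ha1, a2, ha2, rfl⟩ := Submodule.mem_sup.1 hx
  obtain ⟨b1, hb1, b2, hb2, hb⟩ := Submodule.mem_sup.1 hdx
  rw [map_add] at hb
  have hw : dM a1 - b1 = b2 - dM a2 := by
    rw [sub_eq_sub_iff_add_eq_add, ← hb, add_comm]
  have hw12 : dM a1 - b1 ∈ A1 ⊓ A2 :=
    ⟨A1.sub_mem (hs1.1 _ ha1) (hl1 hb1), by rw [hw]; exact A2.sub_mem (hl2 hb2) (hs2.1 _ ha2)⟩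
  have hdw : dM (dM a1 - b1) ∈ A1' ⊓ A2' := by
    constructor
    · rw [map_sub, dM_dM, zero_sub]; exact A1'.neg_mem (hs1'.1 _ hb1)
    · rw [hw, map_sub, dM_dM, sub_zero]; exact hs2'.1 _ hb2
  obtain ⟨y, hy, hw'⟩ := h12 _ hw12 hdw
  obtain ⟨u1, hu1, h1⟩ := h1 (a1 - y) (A1.sub_mem ha1 hy.1) (by
    have : dM (a1 - y) = b1 + (dM a1 - b1 - dM y) := by rw [map_sub]; abel
    rw [this]; exact A1'.add_mem hb1 hw'.1)
  obtain ⟨u2, hu2, h2⟩ := h2 (a2 + y) (A2.add_mem ha2 hy.2) (by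
    have : dM (a2 + y) = b2 - (dM a1 - b1 - dM y) := by rw [hw, map_add]; abel
    rw [this]; exact A2'.sub_mem hb2 hw'.2)
  refine ⟨u1 + u2, Submodule.add_mem_sup hu1 hu2, ?_⟩
  have : a1 + a2 - dM (u1 + u2) = (a1 - y - dM u1) + (a2 + y - dM u2) := by rw [map_add]; abel
  rw [this]
  exact Submodule.add_mem_sup h1 h2

theorem Acyc.of_acyclic (hs : St A) (hAB : A ≤ B) (h1 : Acyc B ⊥) (h2 : Acyc A ⊥) : Acyc B A :=
  h1.top bot_le hAB h2

theorem St.bot : St (⊥ : Submodule ℚ (Ch X)) := by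
  constructor
  · intro x hx; rw [(Submodule.mem_bot ℚ).1 hx, map_zero]; exact Submodule.zero_mem _
  · intro k x hx; rw [(Submodule.mem_bot ℚ).1 hx, map_zero]; exact Submodule.zero_mem _

theorem Acyc.sup_bot (hs1 : St A1) (hs2 : St A2) (h1 : Acyc A1 ⊥) (h2 : Acyc A2 ⊥)
    (h12 : Acyc (A1 ⊓ A2) ⊥) : Acyc (A1 ⊔ A2) ⊥ := by
  have := Acyc.five hs1 hs2 St.bot St.bot bot_le bot_le h1 h2 (by simpa using h12)
  simpa using this

/-- `z` generates the homology of `A` -/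
def Gen (A : Submodule ℚ (Ch X)) (z : Ch X) : Prop :=
  z ∈ A ∧ dM z = 0 ∧ (∀ x ∈ A, dM x = 0 → ∃ y ∈ A, ∃ c : ℚ, x = dM y + c • z) ∧
    ∀ y ∈ A, dM y ≠ z

theorem Acyc.of_gen (hs : St A) (hAB : A ≤ B) {z : Ch X} (h1 : Gen B z) (h2 : Gen A z) :
    Acyc B A := by
  intro x hx hdx
  obtain ⟨a, ha, c, hc⟩ := h2.2.2.1 _ hdx (dM_dM x)
  have hc0 : c = 0 := by
    by_contra hc0
    refine h1.2.2.2 (c⁻¹ • (x - a)) (B.smul_mem _ (B.sub_mem hx (hAB ha))) ?_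
    rw [map_smul, map_sub, hc, add_sub_cancel_left, smul_smul, inv_mul_cancel₀ hc0, one_smul]
  rw [hc0, zero_smul, add_zero] at hc
  obtain ⟨y, hy, c', hc'⟩ := h1.2.2.1 (x - a) (B.sub_mem hx (hAB ha)) (by rw [map_sub, hc, sub_self])
  refine ⟨y, hy, ?_⟩
  have : x - dM y = (x - a) - dM y + a := by abel
  rw [this, hc', add_sub_cancel_left]
  exact A.add_mem (A.smul_mem _ h2.1) ha

theorem Sph.of_acyc (hAB : A ≤ B) (h : Acyc B A) {k : ℕ} (hA : Sph A k) : Sph B k := by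
  obtain ⟨z, hz, hk, hdz, h1, h2⟩ := hA
  refine ⟨z, hAB hz, hk, hdz, fun x hx hdx => ?_, fun y hy hyz => ?_⟩
  · obtain ⟨y, hy, hxy⟩ := h x hx (by rw [hdx]; exact A.zero_mem)
    obtain ⟨y', hy', c, hc⟩ := h1 _ hxy (by rw [map_sub, hdx, dM_dM, sub_zero])
    refine ⟨y + y', B.add_mem hy (hAB hy'), c, ?_⟩
    rw [map_add, add_assoc, ← hc]; abel
  · obtain ⟨u, hu, hyu⟩ := h y hy (by rw [hyz]; exact hz)
    exact h2 _ hyu (by rw [map_sub, dM_dM, sub_zero, hyz])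

theorem Acyc.bot_of_acyc (hAB : A ≤ B) (h : Acyc B A) (hA : Acyc A ⊥) : Acyc B ⊥ :=
  h.trans hAB bot_le hA

theorem Acyc.ex (h : Acyc A ⊥) {x : Ch X} (hx : x ∈ A) (hd : dM x = 0) : ∃ y ∈ A, dM y = x := by
  obtain ⟨y, hy, h⟩ := h x hx (by rw [hd]; exact Submodule.zero_mem _)
  exact ⟨y, hy, (sub_eq_zero.1 ((Submodule.mem_bot ℚ).1 h)).symm⟩

theorem Sph.susp (hs1 : St A1) (hs2 : St A2) (h1 : Acyc A1 ⊥) (h2 : Acyc A2 ⊥) {k : ℕ}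
    (h : Sph (A1 ⊓ A2) k) : Sph (A1 ⊔ A2) (k + 1) := by
  obtain ⟨z, hz, hk, hdz, hg, hn⟩ := h
  obtain ⟨y1, hy1, e1⟩ := h1.ex hz.1 hdz
  obtain ⟨y2, hy2, e2⟩ := h2.ex hz.2 hdz
  have prpr : ∀ x : Ch X, pr (k + 1) (pr (k + 1) x) = pr (k + 1) x := by
    intro x
    suffices h : (pr (k + 1) ∘ₗ pr (k + 1)) x = (pr (k + 1) : Ch X →ₗ[ℚ] Ch X) x from h
    refine Ch_ext (fun j σ => ?_) x
    simp only [LinearMap.comp_apply, pr_sg]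
    split_ifs with h <;> simp [pr_sg, h]
  have d1 : dM (pr (k + 1) y1) = z := by rw [d_pr, e1, hk]
  have d2 : dM (pr (k + 1) y2) = z := by rw [d_pr, e2, hk]
  have m1 := hs1.2 (k + 1) _ hy1
  have m2 := hs2.2 (k + 1) _ hy2
  refine ⟨pr (k + 1) y1 - pr (k + 1) y2, Submodule.sub_mem _ (Submodule.mem_sup_left m1)
    (Submodule.mem_sup_right m2), by rw [map_sub, prpr, prpr], by rw [map_sub, d1, d2, sub_self],
    fun x hx hdx => ?_, fun y hy hyz => ?_⟩
  · obtain ⟨a1, ha1, a2, ha2, rfl⟩ := Submodule.mem_sup.1 hx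
    rw [map_add] at hdx
    have hda : dM a1 = - dM a2 := eq_neg_of_add_eq_zero_left hdx
    obtain ⟨y, hy, c, hc⟩ := hg (dM a1) ⟨hs1.1 _ ha1, by rw [hda]; exact A2.neg_mem (hs2.1 _ ha2)⟩
      (dM_dM _)
    obtain ⟨u1, hu1, f1⟩ := h1.ex (x := a1 - y - c • pr (k + 1) y1)
      (A1.sub_mem (A1.sub_mem ha1 hy.1) (A1.smul_mem _ m1))
      (by rw [map_sub, map_sub, map_smul, d1, hc]; abel)
    obtain ⟨u2, hu2, f2⟩ := h2.ex (x := a2 + y + c • pr (k + 1) y2)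
      (A2.add_mem (A2.add_mem ha2 hy.2) (A2.smul_mem _ m2))
      (by
        rw [map_add, map_add, map_smul, d2]
        have : dM a2 = -dM a1 := by rw [hda, neg_neg]
        rw [this, hc]; abel)
    refine ⟨u1 + u2, Submodule.add_mem_sup hu1 hu2, c, ?_⟩
    rw [map_add, f1, f2, smul_sub]; abel
  · obtain ⟨u1, hu1, u2, hu2, rfl⟩ := Submodule.mem_sup.1 hy
    rw [map_add] at hyz
    have he : pr (k + 1) y1 - dM u1 = pr (k + 1) y2 + dM u2 := by
      rw [sub_eq_iff_eq_add, add_assoc, add_comm (dM u2), hyz]; abel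
    refine hn (pr (k + 1) y1 - dM u1) ⟨A1.sub_mem m1 (hs1.1 _ hu1), ?_⟩
      (by rw [map_sub, dM_dM, d1, sub_zero])
    rw [he]; exact A2.add_mem m2 (hs2.1 _ hu2)

end PC
end

open Complex CategoryTheory

noncomputable section

namespace PC

variable {X : Type} [TopologicalSpace X]

/-- join with a new vertex -/
def jn (k : ℕ) : C(E k × unitInterval, E (k + 1)) where
  toFun x := ⟨Fin.cons x.2.1 (fun i => (1 - x.2.1) * x.1.1 i), by
    constructor
    · intro i
      refine Fin.cases ?_ (fun i => ?_) i
      · exact x.2.2.1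
      · exact mul_nonneg (sub_nonneg.2 x.2.2.2) (x.1.2.1 i)
    · rw [Fin.sum_univ_succ]
      simp [← Finset.mul_sum, x.1.2.2]⟩
  continuous_toFun := by
    refine Continuous.subtype_mk (continuous_pi fun i => ?_) _
    refine Fin.cases ?_ (fun i => ?_) i
    · simp only [Fin.cons_zero]
      fun_prop
    · simp only [Fin.cons_succ]
      exact (by fun_prop : Continuous fun x : E k × unitInterval => 1 - x.2.1).mul
        ((continuous_apply i).comp (continuous_subtype_val.comp continuous_fst))

theorem jn_zero {k : ℕ} (x : E k × unitInterval) : (jn k x).1 0 = x.2.1 := rfl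
theorem jn_succ {k : ℕ} (x : E k × unitInterval) (i : Fin k) :
    (jn k x).1 i.succ = (1 - x.2.1) * x.1.1 i := rfl

theorem jn_surj (k : ℕ) : Function.Surjective (jn (k + 1)) := by
  intro z
  have hz0 := z.2.1 0
  have hsum : z.1 0 + ∑ i : Fin (k + 1), z.1 i.succ = 1 := by
    rw [← Fin.sum_univ_succ (f := z.1)]; exact z.2.2
  have hnn : ∀ i : Fin (k + 1), 0 ≤ z.1 i.succ := fun i => z.2.1 _
  have hz1 : z.1 0 ≤ 1 := by
    have := Finset.sum_nonneg fun i (_ : i ∈ Finset.univ) => hnn i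
    linarith
  by_cases h : z.1 0 = 1
  · refine ⟨(unif k, 1), Subtype.ext (funext fun i => ?_)⟩
    refine Fin.cases ?_ (fun i => ?_) i
    · rw [jn_zero, h]; rfl
    · rw [jn_succ]
      have h0 : ∑ i : Fin (k + 1), z.1 i.succ = 0 := by linarith
      rw [(Finset.sum_eq_zero_iff_of_nonneg fun i _ => hnn i).1 h0 i (Finset.mem_univ _)]
      simp
  · have hp : 0 < 1 - z.1 0 := sub_pos.2 (lt_of_le_of_ne hz1 h)
    refine ⟨(⟨fun i => z.1 i.succ / (1 - z.1 0), fun i => div_nonneg (hnn i) hp.le, ?_⟩,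
      ⟨z.1 0, hz0, hz1⟩), Subtype.ext (funext fun i => ?_)⟩
    · rw [← Finset.sum_div, div_eq_one_iff_eq hp.ne']; linarith
    · refine Fin.cases ?_ (fun i => ?_) i
      · rw [jn_zero]
      · rw [jn_succ]
        simp only
        field_simp

theorem jn_quot (k : ℕ) : Topology.IsQuotientMap (jn (k + 1)) :=
  Topology.IsQuotientMap.of_surjective_continuous (jn_surj k) (jn (k + 1)).continuous

theorem jn_inj {k : ℕ} {a b : E k × unitInterval} (h : jn k a = jn k b) :
    a = b ∨ (a.2 = 1 ∧ b.2 = 1) := by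
  have h0 : a.2.1 = b.2.1 := by rw [← jn_zero, ← jn_zero, h]
  by_cases h1 : b.2 = 1
  · right
    exact ⟨Subtype.ext (h0.trans (congrArg Subtype.val h1)), h1⟩
  · left
    have h1' : 1 - b.2.1 ≠ 0 := fun hh => h1 (Subtype.ext (by
      rw [sub_eq_zero] at hh; exact hh.symm))
    refine Prod.ext (Subtype.ext (funext fun i => ?_)) (Subtype.ext h0)
    have := jn_succ a i
    rw [h, jn_succ, h0] at this
    exact (mul_left_cancel₀ h1' this).symm

theorem coneOf_ft {k : ℕ} (f : C(E (k + 1) × unitInterval, X))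
    (h : ∀ y y', f (y, 1) = f (y', 1)) : Function.FactorsThrough f (jn (k + 1)) := by
  intro a b hab
  rcases jn_inj hab with h' | ⟨h1, h2⟩
  · rw [h']
  · have := h a.1 b.1
    rw [← h1] at this
    nth_rewrite 2 [h1] at this
    rw [← h2] at this
    exact this

def coneOf {k : ℕ} (f : C(E (k + 1) × unitInterval, X)) (h : ∀ y y', f (y, 1) = f (y', 1)) :
    C(E (k + 1 + 1), X) := (jn_quot k).lift f (coneOf_ft f h)

theorem coneOf_jn {k : ℕ} (f : C(E (k + 1) × unitInterval, X)) (h) (x) :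
    coneOf f h (jn (k + 1) x) = f x :=
  congrArg (fun g => g x) (Topology.IsQuotientMap.lift_comp (jn_quot k) f (coneOf_ft f h))

structure Contr (W : Set X) where
  K : C(W × unitInterval, X)
  zero : ∀ x, K (x, 0) = x
  mem : ∀ x t, K (x, t) ∈ W
  const : ∀ k (σ : C(E (k + 1), W)) y y', K (σ y, 1) = K (σ y', 1)

def restr {k : ℕ} {W : Set X} (σ : C(E k, X)) (h : ∀ y, σ y ∈ W) : C(E k, W) :=
  ⟨fun y => ⟨σ y, h y⟩, σ.continuous.subtype_mk h⟩

namespace Contr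

variable {W : Set X} (c : Contr W)

def coneF {k : ℕ} (σ : C(E (k + 1), X)) (h : ∀ y, σ y ∈ W) : C(E (k + 1) × unitInterval, X) :=
  c.K.comp ((restr σ h).prodMap (ContinuousMap.id _))

theorem coneF_apply {k : ℕ} (σ : C(E (k + 1), X)) (h : ∀ y, σ y ∈ W) (y t) :
    c.coneF σ h (y, t) = c.K (⟨σ y, h y⟩, t) := rfl

def coneS {k : ℕ} (σ : C(E (k + 1), X)) (h : ∀ y, σ y ∈ W) : C(E (k + 1 + 1), X) :=
  coneOf (c.coneF σ h) (c.const k (restr σ h))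

theorem coneS_jn {k : ℕ} (σ : C(E (k + 1), X)) (h : ∀ y, σ y ∈ W) (y t) :
    c.coneS σ h (jn (k + 1) (y, t)) = c.K (⟨σ y, h y⟩, t) := coneOf_jn _ _ _

theorem coneS_mem {k : ℕ} (σ : C(E (k + 1), X)) (h : ∀ y, σ y ∈ W) (y) : c.coneS σ h y ∈ W := by
  obtain ⟨⟨y, t⟩, rfl⟩ := jn_surj k y
  rw [coneS_jn]; exact c.mem _ _

theorem coneS_zero {k : ℕ} (σ : C(E (k + 1), X)) (h : ∀ y, σ y ∈ W) :
    (c.coneS σ h).comp (aff (vert (k + 1 + 1) ∘ (0 : Fin (k + 1 + 1)).succAbove)) = σ := by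
  ext y
  have : aff (vert (k + 1 + 1) ∘ (0 : Fin (k + 1 + 1)).succAbove) y = jn (k + 1) (y, 0) := by
    apply Subtype.ext
    funext i
    rw [aff_apply]
    refine Fin.cases ?_ (fun i => ?_) i
    · rw [jn_zero]; simp [vert]
    · rw [jn_succ]; simp [vert, Pi.single_apply]
  rw [ContinuousMap.comp_apply, this, coneS_jn, c.zero]

theorem coneS_succ {k : ℕ} (σ : C(E (k + 1 + 1), X)) (h : ∀ y, σ y ∈ W) (j : Fin (k + 1 + 1)) :
    (c.coneS σ h).comp (aff (vert (k + 1 + 1 + 1) ∘ j.succ.succAbove)) =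
      c.coneS (σ.comp (aff (vert (k + 1 + 1) ∘ j.succAbove))) (fun _ => h _) := by
  ext y
  obtain ⟨⟨y, t⟩, rfl⟩ := jn_surj k y
  have : aff (vert (k + 1 + 1 + 1) ∘ j.succ.succAbove) (jn (k + 1) (y, t)) =
      jn (k + 1 + 1) (aff (vert (k + 1 + 1) ∘ j.succAbove) y, t) := by
    apply Subtype.ext
    funext i
    rw [aff_apply, Fin.sum_univ_succ]
    refine Fin.cases ?_ (fun i => ?_) i
    · rw [jn_zero, jn_zero]; simp [vert]
    · rw [jn_succ, jn_zero, aff_apply, Finset.mul_sum]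
      simp only [jn_succ, vert, Function.comp, Fin.succ_succAbove_zero, Fin.succ_succAbove_succ,
        Pi.single_apply, Fin.succ_inj, mul_assoc]
      simp
  rw [ContinuousMap.comp_apply, this, coneS_jn, coneS_jn]
  rfl

theorem coneS_last (σ : C(E (0 + 1), X)) (h : ∀ y, σ y ∈ W) (j : Fin (0 + 1)) :
    (c.coneS σ h).comp (aff (vert (0 + 1 + 1) ∘ j.succ.succAbove)) =
      ContinuousMap.const _ (c.K (⟨σ (unif 0), h _⟩, 1)) := by
  ext y
  have : aff (vert (0 + 1 + 1) ∘ j.succ.succAbove) y = jn (0 + 1) (unif 0, 1) := by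
    have hy : y.1 0 = 1 := by have := y.2.2; simpa using this
    have hj : j = 0 := Fin.ext (by omega)
    subst hj
    apply Subtype.ext
    funext i
    rw [aff_apply]
    refine Fin.cases ?_ (fun i => ?_) i
    · rw [jn_zero]; simp [vert, hy]
    · rw [jn_succ]; simp [vert]
  rw [ContinuousMap.comp_apply, this, coneS_jn]
  rfl

open Classical in
def coneX : Ch X →ₗ[ℚ] Ch X :=
  Finsupp.linearCombination ℚ fun s => if h : ∀ y, s.2 y ∈ W then sg (c.coneS s.2 h) else 0

open Classical in
def rV : Sg X → Ch X
  | ⟨0, σ⟩ => if h : ∀ y, σ y ∈ W then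
      sg (k := 0) (ContinuousMap.const _ (c.K (⟨σ (unif 0), h _⟩, 1))) else 0
  | ⟨_ + 1, _⟩ => 0

def rX : Ch X →ₗ[ℚ] Ch X := Finsupp.linearCombination ℚ c.rV

theorem coneX_sg {k : ℕ} (σ : C(E (k + 1), X)) (h : ∀ y, σ y ∈ W) :
    c.coneX (sg σ) = sg (c.coneS σ h) := by
  rw [coneX, Finsupp.linearCombination_single, one_smul, dif_pos h]

theorem rX_sg0 (σ : C(E (0 + 1), X)) (h : ∀ y, σ y ∈ W) :
    c.rX (sg σ) = sg (k := 0) (ContinuousMap.const _ (c.K (⟨σ (unif 0), h _⟩, 1))) := by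
  rw [rX, Finsupp.linearCombination_single, one_smul, rV, dif_pos h]

theorem rX_sg1 {k : ℕ} (σ : C(E (k + 1 + 1), X)) : c.rX (sg σ) = 0 := by
  rw [rX, Finsupp.linearCombination_single, one_smul, rV]

theorem d_cone {x : Ch X} (hx : x ∈ SC W) :
    dM (c.coneX x) = x - c.coneX (dM x) - c.rX x := by
  have : SC W ≤ LinearMap.eqLocus (dM ∘ₗ c.coneX) (LinearMap.id - c.coneX ∘ₗ dM - c.rX) := by
    refine SC_induct fun k σ h => ?_
    rw [LinearMap.mem_eqLocus]
    simp only [LinearMap.comp_apply, LinearMap.sub_apply, LinearMap.id_apply]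
    rw [coneX_sg _ _ h, dM_sg, Fin.sum_univ_succ, coneS_zero]
    cases k with
    | zero =>
      rw [rX_sg0 _ _ h, dM_sg0, map_zero, sub_zero, Fin.sum_univ_succ, coneS_last]
      simp [sub_eq_add_neg]
    | succ k =>
      rw [rX_sg1, sub_zero, dM_sg, map_sum, sub_eq_add_neg, ← Finset.sum_neg_distrib]
      simp only [Fin.val_zero, pow_zero, one_smul]
      congr 1
      refine Finset.sum_congr rfl fun j _ => ?_
      have hj : ∀ y, (σ.comp (aff (vert (k + 1 + 1) ∘ j.succAbove))) y ∈ W := fun _ => h _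
      rw [map_smul, coneX_sg _ _ hj, coneS_succ, Fin.val_succ, pow_succ,
        mul_neg_one, neg_smul]
  exact this hx

theorem coneX_mem {x : Ch X} (hx : x ∈ SC W) : c.coneX x ∈ SC W := by
  have : SC W ≤ (SC W).comap c.coneX := SC_induct fun k σ h => by
    rw [Submodule.mem_comap, coneX_sg _ _ h]
    exact sg_mem_SC (c.coneS_mem σ h)
  exact this hx

theorem rX_mem {x : Ch X} (hx : x ∈ SC W) : c.rX x ∈ SC W := by
  have : SC W ≤ (SC W).comap c.rX := SC_induct fun k σ h => by
    rw [Submodule.mem_comap]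
    cases k with
    | zero => rw [rX_sg0 _ _ h]; exact sg_mem_SC fun _ => c.mem _ _
    | succ k => rw [rX_sg1]; exact Submodule.zero_mem _
  exact this hx

theorem d_rX {x : Ch X} (hx : x ∈ SC W) : dM (c.rX x) = 0 := by
  have : SC W ≤ LinearMap.ker (dM ∘ₗ c.rX) := SC_induct fun k σ h => by
    rw [LinearMap.mem_ker, LinearMap.comp_apply]
    cases k with
    | zero => rw [rX_sg0 _ _ h, dM_sg0]
    | succ k => rw [rX_sg1, map_zero]
  exact this hx

theorem rX_d {x : Ch X} (hx : x ∈ SC W) : c.rX (dM x) = 0 := by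
  have hdx : dM x ∈ SC W := op_mem_SC _ hx
  have h1 := c.d_cone hdx
  rw [dM_dM, map_zero, sub_zero] at h1
  have h2 : c.coneX (dM x) = x - dM (c.coneX x) - c.rX x := by rw [c.d_cone hx]; abel
  rw [h2, map_sub, map_sub, dM_dM, sub_zero, c.d_rX hx, sub_zero] at h1
  exact sub_eq_self.1 h1.symm

theorem coneX_equiv (f : C(X, X)) (hf : ∀ x ∈ W, f x ∈ W)
    (hK : ∀ (x : W) t, f (c.K (x, t)) = c.K (⟨f x.1, hf _ x.2⟩, t)) {x : Ch X} (hx : x ∈ SC W) :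
    pM f (c.coneX x) = c.coneX (pM f x) := by
  have : SC W ≤ LinearMap.eqLocus (pM f ∘ₗ c.coneX) (c.coneX ∘ₗ pM f) := by
    refine SC_induct fun k σ h => ?_
    rw [LinearMap.mem_eqLocus]
    simp only [LinearMap.comp_apply]
    rw [coneX_sg _ _ h, pM_sg, pM_sg, coneX_sg _ _ fun y => hf _ (h y)]
    refine congrArg (fun σ => sg σ) (ContinuousMap.ext fun y => ?_)
    obtain ⟨⟨y, t⟩, rfl⟩ := jn_surj k y
    rw [ContinuousMap.comp_apply, coneS_jn, coneS_jn, hK]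
    rfl
  exact this hx

theorem rX_equiv (f : C(X, X)) (hf : ∀ x ∈ W, f x ∈ W)
    (hK : ∀ (x : W) t, f (c.K (x, t)) = c.K (⟨f x.1, hf _ x.2⟩, t)) {x : Ch X} (hx : x ∈ SC W) :
    pM f (c.rX x) = c.rX (pM f x) := by
  have : SC W ≤ LinearMap.eqLocus (pM f ∘ₗ c.rX) (c.rX ∘ₗ pM f) := by
    refine SC_induct fun k σ h => ?_
    rw [LinearMap.mem_eqLocus]
    simp only [LinearMap.comp_apply]
    cases k with
    | zero =>
      rw [rX_sg0 _ _ h, pM_sg, pM_sg, rX_sg0 _ _ fun y => hf _ (h y)]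
      refine congrArg (fun σ => sg σ) (ContinuousMap.ext fun y => ?_)
      rw [ContinuousMap.comp_apply, ContinuousMap.const_apply, hK]
      rfl
    | succ k => rw [rX_sg1, pM_sg, rX_sg1, map_zero]
  exact this hx

end Contr

end PC
end

open Complex CategoryTheory

noncomputable section

namespace PC

abbrev Gp (n : ℕ) : Type := Fin n → ZMod 2

def sg2 (a : ZMod 2) : ℚ := if a = 0 then 1 else -1

theorem sg2_add (a b : ZMod 2) : sg2 (a + b) = sg2 a * sg2 b := by
  revert a b
  have : ∀ a : ZMod 2, a = 0 ∨ a = 1 := by decide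
  intro a b
  have h2 : (1 + 1 : ZMod 2) = 0 := rfl
  rcases this a with rfl | rfl <;> rcases this b with rfl | rfl <;> simp [sg2, h2]

theorem sg2_sq (a : ZMod 2) : sg2 a * sg2 a = 1 := by
  unfold sg2; split_ifs <;> norm_num

/-- the sign character -/
def chr {n : ℕ} (ω g : Gp n) : ℚ := sg2 (∑ j, ω j * g j)

theorem chr_add {n : ℕ} (ω g h : Gp n) : chr ω (g + h) = chr ω g * chr ω h := by
  simp only [chr, ← sg2_add, Pi.add_apply, mul_add, Finset.sum_add_distrib]

theorem chr_zero {n : ℕ} (ω : Gp n) : chr ω 0 = 1 := by simp [chr, sg2]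

theorem chr_sq {n : ℕ} (ω g : Gp n) : chr ω g * chr ω g = 1 := sg2_sq _

theorem Gp_add_self {n : ℕ} (g : Gp n) : g + g = 0 := by
  funext i
  have : ∀ a : ZMod 2, a + a = 0 := by decide
  exact this _

theorem Gp_neg {n : ℕ} (g : Gp n) : -g = g := neg_eq_of_add_eq_zero_left (Gp_add_self g)

structure Mir (n : ℕ) (P 𝓕 X : Type) [TopologicalSpace P] [TopologicalSpace X] where
  ℓ : 𝓕 → P → ℝ
  ℓ_cont : ∀ F, Continuous (ℓ F)
  ℓ_nonneg : ∀ F p, 0 ≤ ℓ F p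
  χ : 𝓕 → Gp n
  cv : P → P → unitInterval → P
  cv_cont : ∀ q, Continuous fun x : P × unitInterval => cv x.1 q x.2
  cv_ℓ : ∀ F p q t, ℓ F (cv p q t) = (1 - t.1) * ℓ F p + t.1 * ℓ F q
  cv_zero : ∀ p q, cv p q 0 = p
  cv_one : ∀ p q, cv p q 1 = q
  compat : 𝓕 → 𝓕 → Prop
  compat_symm : ∀ F F', compat F F' → compat F' F
  disj : ∀ F F', ¬ compat F F' → ∀ p, ¬ (ℓ F p = 0 ∧ ℓ F' p = 0)
  flag : ∀ A : Finset 𝓕, (∀ F ∈ A, ∀ F' ∈ A, compat F F') → ∃ p, ∀ F, ℓ F p = 0 ↔ F ∈ A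
  q : Gp n × P → X
  q_quot : Topology.IsQuotientMap q
  q_eq : ∀ g p g' p', q (g, p) = q (g', p') ↔
    p = p' ∧ g + g' ∈ Submodule.span (ZMod 2) {v | ∃ F, ℓ F p = 0 ∧ v = χ F}

set_option linter.unusedSectionVars false

namespace Mir

variable {n : ℕ} {P 𝓕 X : Type} [TopologicalSpace P] [TopologicalSpace X]
  (M : Mir n P 𝓕 X)

def H (p : P) : Submodule (ZMod 2) (Gp n) := Submodule.span (ZMod 2) {v | ∃ F, M.ℓ F p = 0 ∧ v = M.χ F}

theorem H_mono {p p' : P} (h : ∀ F, M.ℓ F p = 0 → M.ℓ F p' = 0) : M.H p ≤ M.H p' :=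
  Submodule.span_mono fun _ ⟨F, hF, hv⟩ => ⟨F, h F hF, hv⟩

theorem q_surj (x : X) : ∃ g p, M.q (g, p) = x := by
  obtain ⟨⟨g, p⟩, h⟩ := M.q_quot.surjective x
  exact ⟨g, p, h⟩

/-- projection to the polytope -/
def pX (x : X) : P := (M.q_surj x).choose_spec.choose

theorem pX_q (g : Gp n) (p : P) : M.pX (M.q (g, p)) = p :=
  ((M.q_eq _ _ _ _).1 (M.q_surj (M.q (g, p))).choose_spec.choose_spec).1

theorem pX_cont : Continuous M.pX := by
  rw [M.q_quot.continuous_iff]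
  have : M.pX ∘ M.q = Prod.snd := by funext ⟨g, p⟩; exact M.pX_q g p
  rw [this]; exact continuous_snd

def actF (g : Gp n) (x : X) : X := M.q (g + (M.q_surj x).choose, M.pX x)

theorem actF_q (g h : Gp n) (p : P) : M.actF g (M.q (h, p)) = M.q (g + h, p) := by
  have h1 := (M.q_surj (M.q (h, p))).choose_spec.choose_spec
  obtain ⟨h2, h3⟩ := (M.q_eq _ _ _ _).1 h1
  rw [actF, pX_q, M.q_eq]
  refine ⟨rfl, ?_⟩
  rw [h2] at h3
  have : ∀ a b c : Gp n, a + b + (a + c) = b + c := fun a b c => by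
    rw [add_add_add_comm, Gp_add_self, zero_add]
  rw [this]
  exact h3

def act (g : Gp n) : C(X, X) := ⟨M.actF g, by
  rw [M.q_quot.continuous_iff]
  have : M.actF g ∘ M.q = M.q ∘ fun x => (g + x.1, x.2) := by
    funext ⟨h, p⟩; exact M.actF_q g h p
  rw [this]
  exact M.q_quot.continuous.comp (by fun_prop)⟩

theorem act_q (g h : Gp n) (p : P) : M.act g (M.q (h, p)) = M.q (g + h, p) := M.actF_q g h p

theorem act_act (g h : Gp n) : (M.act g).comp (M.act h) = M.act (g + h) := by
  ext x
  obtain ⟨g', p, rfl⟩ := M.q_surj x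
  rw [ContinuousMap.comp_apply, act_q, act_q, act_q, add_assoc]

theorem act_zero : M.act 0 = ContinuousMap.id X := by
  ext x
  obtain ⟨g', p, rfl⟩ := M.q_surj x
  rw [act_q, zero_add]; rfl

theorem pX_act (g : Gp n) (x : X) : M.pX (M.act g x) = M.pX x := by
  obtain ⟨g', p, rfl⟩ := M.q_surj x
  rw [act_q, pX_q, pX_q]

def U (A : Finset 𝓕) : Set P := {p | ∀ F, F ∉ A → M.ℓ F p ≠ 0}
def XA (A : Finset 𝓕) : Set X := M.pX ⁻¹' M.U A

theorem U_open [Finite 𝓕] (A : Finset 𝓕) : IsOpen (M.U A) := by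
  have : M.U A = ⋂ F, {p | F ∉ A → M.ℓ F p ≠ 0} := by ext; simp [U]
  rw [this]
  refine isOpen_iInter_of_finite fun F => ?_
  by_cases h : F ∈ A
  · simp [h]
  · simp only [h, not_false_eq_true, true_imp_iff]
    exact isOpen_ne_fun (M.ℓ_cont F) continuous_const

theorem XA_open [Finite 𝓕] (A : Finset 𝓕) : IsOpen (M.XA A) := (M.U_open A).preimage M.pX_cont

theorem act_mem {A : Finset 𝓕} (g : Gp n) (x : X) (hx : x ∈ M.XA A) : M.act g x ∈ M.XA A := by
  rw [XA, Set.mem_preimage, pX_act]; exact hx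

variable [DecidableEq 𝓕]

theorem XA_inter (A B : Finset 𝓕) : M.XA (A ∩ B) = M.XA A ∩ M.XA B := by
  ext x
  simp only [XA, U, Set.mem_preimage, Set.mem_inter_iff, Set.mem_ofPred_eq, Finset.mem_inter]
  constructor
  · exact fun h => ⟨fun F hF => h F fun h => hF h.1, fun F hF => h F fun h => hF h.2⟩
  · rintro ⟨h1, h2⟩ F hF
    by_cases h : F ∈ A
    · exact h2 F fun h' => hF ⟨h, h'⟩
    · exact h1 F h

theorem XA_mono {A B : Finset 𝓕} (h : A ⊆ B) : M.XA A ⊆ M.XA B :=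
  fun _ hx F hF => hx F fun h' => hF (h h')

theorem XA_cover {A : Finset 𝓕} {F1 F2 : 𝓕} (h : ¬ M.compat F1 F2) :
    M.XA A = M.XA (A.erase F1) ∪ M.XA (A.erase F2) := by
  apply Set.Subset.antisymm
  · intro x hx
    by_cases h1 : M.ℓ F1 (M.pX x) = 0
    · right
      intro F hF
      by_cases hF2 : F = F2
      · rw [hF2]; exact fun h2 => M.disj _ _ h _ ⟨h1, h2⟩
      · exact hx F fun h' => hF (Finset.mem_erase.2 ⟨hF2, h'⟩)
    · left
      intro F hF
      by_cases hF1 : F = F1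
      · rw [hF1]; exact h1
      · exact hx F fun h' => hF (Finset.mem_erase.2 ⟨hF1, h'⟩)
  · exact Set.union_subset (M.XA_mono (Finset.erase_subset _ _)) (M.XA_mono (Finset.erase_subset _ _))

/-! isotypic parts -/

def C (ω : Gp n) (A : Finset 𝓕) : Submodule ℚ (Ch X) :=
  SC (M.XA A) ⊓ ⨅ g : Gp n, LinearMap.eqLocus (pM (M.act g)) (chr ω g • LinearMap.id)

theorem mem_C {ω : Gp n} {A : Finset 𝓕} {x : Ch X} :
    x ∈ M.C ω A ↔ x ∈ SC (M.XA A) ∧ ∀ g, pM (M.act g) x = chr ω g • x := by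
  simp [C, Submodule.mem_iInf, LinearMap.mem_eqLocus]

def e (ω : Gp n) : Ch X →ₗ[ℚ] Ch X := ((2 : ℚ) ^ n)⁻¹ • ∑ g : Gp n, chr ω g • pM (M.act g)

theorem e_apply (ω : Gp n) (x : Ch X) :
    M.e ω x = ((2 : ℚ) ^ n)⁻¹ • ∑ g : Gp n, chr ω g • pM (M.act g) x := by
  simp [e, LinearMap.sum_apply]

theorem pM_comp (f g : C(X, X)) (x : Ch X) : pM f (pM g x) = pM (f.comp g) x := by
  suffices h : (pM f ∘ₗ pM g) x = pM (f.comp g) x from h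
  refine Ch_ext (fun j σ => ?_) x
  simp only [LinearMap.comp_apply, pM_sg, ContinuousMap.comp_assoc]

theorem pM_mem {A : Finset 𝓕} {x : Ch X} (hx : x ∈ SC (M.XA A)) (g : Gp n) :
    pM (M.act g) x ∈ SC (M.XA A) := by
  have : SC (M.XA A) ≤ (SC (M.XA A)).comap (pM (M.act g)) := SC_induct fun k σ h => by
    rw [Submodule.mem_comap, pM_sg]
    exact sg_mem_SC fun y => M.act_mem _ _ (h y)
  exact this hx

theorem e_mem (ω : Gp n) {A : Finset 𝓕} {x : Ch X} (hx : x ∈ SC (M.XA A)) :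
    M.e ω x ∈ M.C ω A := by
  rw [mem_C]
  constructor
  · rw [e_apply]
    exact Submodule.smul_mem _ _ (Submodule.sum_mem _ fun g _ => Submodule.smul_mem _ _ (M.pM_mem hx g))
  · intro h
    rw [e_apply, map_smul, smul_comm, map_sum]
    congr 1
    rw [Finset.smul_sum, ← Equiv.sum_comp (Equiv.addLeft h)]
    refine Finset.sum_congr rfl fun g _ => ?_
    rw [map_smul, pM_comp, act_act, Equiv.coe_addLeft, chr_add, ← add_assoc, Gp_add_self, zero_add,
      mul_smul]

theorem e_fix {ω : Gp n} {x : Ch X} (h : ∀ g, pM (M.act g) x = chr ω g • x) : M.e ω x = x := by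
  rw [e_apply]
  simp only [h, smul_smul, chr_sq, one_smul]
  simp [smul_smul, ← Nat.cast_smul_eq_nsmul ℚ]

theorem d_e (ω : Gp n) (x : Ch X) : dM (M.e ω x) = M.e ω (dM x) := by
  simp only [e_apply, map_smul, map_sum, pM_d]

theorem pr_e (ω : Gp n) (k : ℕ) (x : Ch X) : pr k (M.e ω x) = M.e ω (pr k x) := by
  simp only [e_apply, map_smul, map_sum, pr_pM]

theorem C_St (ω : Gp n) (A : Finset 𝓕) : St (M.C ω A) := by
  constructor
  · intro x hx
    rw [mem_C] at hx ⊢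
    exact ⟨op_mem_SC _ hx.1, fun g => by rw [pM_d, hx.2, map_smul]⟩
  · intro k x hx
    rw [mem_C] at hx ⊢
    exact ⟨pr_mem_SC _ hx.1, fun g => by rw [← pr_pM, hx.2, map_smul]⟩

theorem C_mono (ω : Gp n) {A B : Finset 𝓕} (h : A ⊆ B) : M.C ω A ≤ M.C ω B :=
  inf_le_inf_right _ (SC_mono (M.XA_mono h))

theorem C_inter (ω : Gp n) (A B : Finset 𝓕) : M.C ω A ⊓ M.C ω B = M.C ω (A ∩ B) := by
  rw [C, C, C, XA_inter, SC_inter, inf_inf_inf_comm, inf_idem]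

theorem C_erase (ω : Gp n) (A : Finset 𝓕) (F1 F2 : 𝓕) :
    M.C ω (A.erase F1) ⊓ M.C ω (A.erase F2) = M.C ω ((A.erase F1).erase F2) := by
  rw [C_inter]; congr 1; ext; simp only [Finset.mem_inter, Finset.mem_erase]; tauto

theorem small [Finite 𝓕] (ω : Gp n) (A : Finset 𝓕) {F1 F2 : 𝓕} (h : ¬ M.compat F1 F2) :
    Acyc (M.C ω A) (M.C ω (A.erase F1) ⊔ M.C ω (A.erase F2)) := by
  intro x hx hdx
  have hc := M.XA_cover (A := A) h
  have hx' := (M.mem_C.1 hx)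
  obtain ⟨y, hy, hxy⟩ := small_thm (M.XA_open (A.erase F1)) (M.XA_open (A.erase F2)) (x := x)
    (by rw [← hc]; exact hx'.1) ((sup_le_sup (inf_le_left : M.C ω (A.erase F1) ≤ SC _)
      (inf_le_left : M.C ω (A.erase F2) ≤ SC _)) hdx)
  rw [← hc] at hy
  refine ⟨M.e ω y, M.e_mem ω hy, ?_⟩
  have : x - dM (M.e ω y) = M.e ω (x - dM y) := by rw [map_sub, M.e_fix hx'.2, d_e]
  rw [this]
  obtain ⟨u, hu, v, hv, huv⟩ := Submodule.mem_sup.1 hxy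
  rw [← huv, map_add]
  exact Submodule.add_mem_sup (M.e_mem ω hu) (M.e_mem ω hv)

/-! stars -/

def Kf (pA : P) {A : Finset 𝓕} (x : M.XA A × unitInterval) : X :=
  M.q ((M.q_surj x.1.1).choose, M.cv (M.pX x.1.1) pA x.2)

theorem Kf_q {pA : P} {A : Finset 𝓕} (hp : ∀ F, M.ℓ F pA = 0 ↔ F ∈ A) (g : Gp n) (p : P)
    (h : M.q (g, p) ∈ M.XA A) (t : unitInterval) :
    M.Kf pA (⟨M.q (g, p), h⟩, t) = M.q (g, M.cv p pA t) := by
  have h1 := (M.q_surj (M.q (g, p))).choose_spec.choose_spec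
  obtain ⟨h2, h3⟩ := (M.q_eq _ _ _ _).1 h1
  rw [Kf]
  simp only [pX_q]
  rw [M.q_eq]
  refine ⟨rfl, ?_⟩
  rw [h2] at h3
  refine M.H_mono (p := p) (fun F hF => ?_) h3
  have hFA : F ∈ A := by
    by_contra hFA
    have := h F hFA
    rw [pX_q] at this
    exact this hF
  rw [M.cv_ℓ, hF, (hp F).2 hFA]; ring

theorem Kf_cont [Finite 𝓕] {pA : P} {A : Finset 𝓕} (hp : ∀ F, M.ℓ F pA = 0 ↔ F ∈ A) :
    Continuous (M.Kf pA (A := A)) := by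
  have hq := M.q_quot.restrictPreimage_isOpen (M.XA_open A)
  refine hq.continuous_lift_prod_left ?_
  have : (fun p : (M.q ⁻¹' M.XA A) × unitInterval =>
      M.Kf pA ((M.XA A).restrictPreimage M.q p.1, p.2)) =
      fun p => M.q (p.1.1.1, M.cv p.1.1.2 pA p.2) := by
    funext ⟨⟨⟨g, p⟩, h⟩, t⟩
    exact M.Kf_q hp g p h t
  rw [this]
  refine M.q_quot.continuous.comp ?_
  have h1 := M.cv_cont pA
  exact Continuous.prodMk (by fun_prop) (h1.comp
    (f := fun p : (M.q ⁻¹' M.XA A) × unitInterval => (p.1.1.2, p.2)) (by fun_prop))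

theorem t1 (M : Mir n P 𝓕 X) [T1Space P] : T1Space X := by
  refine ⟨fun x => ?_⟩
  rw [← M.q_quot.isClosed_preimage]
  obtain ⟨g, p, rfl⟩ := M.q_surj x
  have : M.q ⁻¹' {M.q (g, p)} = {g' | g' + g ∈ M.H p} ×ˢ {p} := by
    ext ⟨g', p'⟩
    simp only [Set.mem_preimage, Set.mem_singleton_iff, Set.mem_prod, M.q_eq]
    constructor
    · rintro ⟨rfl, h⟩; exact ⟨h, rfl⟩
    · rintro ⟨h, h2⟩; subst h2; exact ⟨rfl, h⟩
  rw [this]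
  exact (isClosed_discrete _).prod isClosed_singleton

instance {k : ℕ} : PreconnectedSpace (E (k + 1)) :=
  Subtype.preconnectedSpace (convex_stdSimplex ℝ _).isPreconnected

def contr [T1Space P] [Finite 𝓕] {pA : P} {A : Finset 𝓕} (hp : ∀ F, M.ℓ F pA = 0 ↔ F ∈ A) :
    Contr (M.XA A) where
  K := ⟨M.Kf pA, M.Kf_cont hp⟩
  zero := by
    rintro ⟨x, h⟩
    obtain ⟨g, p, rfl⟩ := M.q_surj x
    rw [ContinuousMap.coe_mk, M.Kf_q hp, M.cv_zero]
  mem := by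
    rintro ⟨x, h⟩ t
    obtain ⟨g, p, rfl⟩ := M.q_surj x
    rw [ContinuousMap.coe_mk, M.Kf_q hp]
    intro F hF
    have h1 := h F hF
    rw [pX_q] at h1 ⊢
    rw [M.cv_ℓ]
    have h2 : M.ℓ F pA ≠ 0 := fun h => hF ((hp F).1 h)
    have h3 := lt_of_le_of_ne (M.ℓ_nonneg F p) h1.symm
    have h4 := lt_of_le_of_ne (M.ℓ_nonneg F pA) h2.symm
    apply ne_of_gt
    rcases t.2.1.lt_or_eq with h5 | h5
    · exact add_pos_of_nonneg_of_pos (mul_nonneg (sub_nonneg.2 t.2.2) h3.le) (mul_pos h5 h4)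
    · rw [← h5]; simpa using h3
  const := by
    intro k σ y y'
    have := M.t1
    let T : Set X := Set.range fun g : Gp n => M.q (g, pA)
    have : Finite T := Set.finite_range _
    have : DiscreteTopology T := inferInstance
    refine isPreconnected_univ.constant_of_mapsTo (S := Set.univ) (T := T)
      (f := fun y => M.Kf pA (σ y, 1)) (isDiscrete_iff_discreteTopology.2 this) ?_ ?_ (Set.mem_univ _) (Set.mem_univ _)
    · refine Continuous.continuousOn ?_
      exact (M.Kf_cont hp).comp (by fun_prop)
    · intro y _
      have : ∀ w : M.XA A, M.Kf pA (w, 1) ∈ T := by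
        rintro ⟨x, h⟩
        obtain ⟨g, p, rfl⟩ := M.q_surj x
        rw [M.Kf_q hp, M.cv_one]
        exact ⟨g, rfl⟩
      exact this _

end Mir
end PC
end

open Complex CategoryTheory

noncomputable section

namespace PC
set_option linter.unusedSectionVars false
namespace Mir

variable {n : ℕ} {P 𝓕 X : Type} [TopologicalSpace P] [TopologicalSpace X]
  (M : Mir n P 𝓕 X) [DecidableEq 𝓕] [T1Space P] [Finite 𝓕]

theorem contr_q {pA : P} {A : Finset 𝓕} (hp : ∀ F, M.ℓ F pA = 0 ↔ F ∈ A) (g : Gp n) (p : P)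
    (h : M.q (g, p) ∈ M.XA A) (t : unitInterval) :
    (M.contr hp).K (⟨M.q (g, p), h⟩, t) = M.q (g, M.cv p pA t) := M.Kf_q hp g p h t

theorem contr_equiv {pA : P} {A : Finset 𝓕} (hp : ∀ F, M.ℓ F pA = 0 ↔ F ∈ A) (g : Gp n)
    (x : M.XA A) (t : unitInterval) :
    M.act g ((M.contr hp).K (x, t)) = (M.contr hp).K (⟨M.act g x.1, M.act_mem g _ x.2⟩, t) := by
  obtain ⟨x, h⟩ := x
  obtain ⟨g', p, rfl⟩ := M.q_surj x
  have h' := M.act_mem g _ h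
  rw [act_q] at h'
  have : (⟨M.act g (M.q (g', p)), M.act_mem g _ h⟩ : M.XA A) = ⟨M.q (g + g', p), h'⟩ :=
    Subtype.ext (M.act_q _ _ _)
  simp only [this]
  rw [contr_q, contr_q, act_q]

/-- a vertex chain -/
def pt (g : Gp n) (p : P) : Ch X := sg (k := 0) (ContinuousMap.const _ (M.q (g, p)))

theorem act_pt (g h : Gp n) (p : P) : pM (M.act g) (M.pt h p) = M.pt (g + h) p := by
  rw [pt, pM_sg, pt]
  refine congrArg (fun σ => sg σ) (ContinuousMap.ext fun y => ?_)
  exact M.act_q _ _ _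

theorem pt_mem {A : Finset 𝓕} (g : Gp n) {p : P} (hp : p ∈ M.U A) : M.pt g p ∈ SC (M.XA A) :=
  sg_mem_SC fun _ => by
    rw [ContinuousMap.const_apply, XA, Set.mem_preimage, pX_q]; exact hp

theorem d_pt (g : Gp n) (p : P) : dM (M.pt g p) = 0 := dM_sg0 _

theorem e_pt (ω g : Gp n) (p : P) : M.e ω (M.pt g p) = chr ω g • M.e ω (M.pt 0 p) := by
  rw [e_apply, e_apply, smul_comm]
  congr 1
  rw [Finset.smul_sum, ← Equiv.sum_comp (Equiv.addLeft g)]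
  refine Finset.sum_congr rfl fun h _ => ?_
  rw [Equiv.coe_addLeft, act_pt, act_pt, chr_add, mul_smul, add_zero, add_assoc, add_comm h g,
    ← add_assoc, Gp_add_self, zero_add]

section star
variable {pA : P} {A : Finset 𝓕} (hp : ∀ F, M.ℓ F pA = 0 ↔ F ∈ A)

include hp

theorem pA_mem : pA ∈ M.U A := fun F hF h => hF ((hp F).1 h)

theorem rX_pt (g : Gp n) {p : P} (hpU : p ∈ M.U A) : (M.contr hp).rX (M.pt g p) = M.pt g pA := by
  have h : M.q (g, p) ∈ M.XA A := by rw [XA, Set.mem_preimage, pX_q]; exact hpU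
  rw [pt, Contr.rX_sg0 _ _ (fun y => by exact h), pt]
  refine congrArg (fun σ => sg σ) (ContinuousMap.ext fun y => ?_)
  simp only [ContinuousMap.const_apply]
  rw [contr_q, M.cv_one]

theorem rX_span {x : Ch X} (hx : x ∈ SC (M.XA A)) :
    (M.contr hp).rX x ∈ Submodule.span ℚ (Set.range fun g => M.pt g pA) := by
  have : SC (M.XA A) ≤ (Submodule.span ℚ (Set.range fun g => M.pt g pA)).comap (M.contr hp).rX :=
    SC_induct fun k σ h => by
      rw [Submodule.mem_comap]
      cases k with
      | zero =>
        rw [Contr.rX_sg0 _ _ h]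
        refine Submodule.subset_span ?_
        have h' := h (unif 0)
        obtain ⟨g, p, hgp⟩ := M.q_surj (σ (unif 0))
        refine ⟨g, ?_⟩
        have e1 : (⟨σ (unif 0), h'⟩ : M.XA A) = ⟨M.q (g, p), by rw [hgp]; exact h'⟩ :=
          Subtype.ext hgp.symm
        simp only [e1]
        rw [contr_q, M.cv_one]; rfl
      | succ k => rw [Contr.rX_sg1]; exact Submodule.zero_mem _
  exact this hx

theorem cone_C {ω : Gp n} {x : Ch X} (hx : x ∈ M.C ω A) : (M.contr hp).coneX x ∈ M.C ω A := by
  rw [mem_C] at hx ⊢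
  refine ⟨Contr.coneX_mem _ hx.1, fun g => ?_⟩
  rw [Contr.coneX_equiv _ _ (fun x hx => M.act_mem g x hx) (M.contr_equiv hp g) hx.1, hx.2, map_smul]

theorem rX_eig {ω : Gp n} {x : Ch X} (hx : x ∈ M.C ω A) (g : Gp n) :
    pM (M.act g) ((M.contr hp).rX x) = chr ω g • (M.contr hp).rX x := by
  rw [mem_C] at hx
  rw [Contr.rX_equiv _ _ (fun x hx => M.act_mem g x hx) (M.contr_equiv hp g) hx.1, hx.2, map_smul]

theorem star_eq {ω : Gp n} {x : Ch X} (hx : x ∈ M.C ω A) (hd : dM x = 0) :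
    x = dM ((M.contr hp).coneX x) + (M.contr hp).rX x := by
  rw [Contr.d_cone _ (M.mem_C.1 hx).1, hd, map_zero]; abel

theorem star_neg {ω : Gp n} {F : 𝓕} (hF : F ∈ A) (hs : chr ω (M.χ F) ≠ 1) : Acyc (M.C ω A) ⊥ := by
  intro x hx hdx
  rw [Submodule.mem_bot] at hdx
  refine ⟨_, M.cone_C hp hx, ?_⟩
  have h1 := M.star_eq hp hx hdx
  have h2 : (M.contr hp).rX x = 0 := by
    have h3 : pM (M.act (M.χ F)) ((M.contr hp).rX x) = (M.contr hp).rX x := by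
      have : Submodule.span ℚ (Set.range fun g => M.pt g pA) ≤
          LinearMap.eqLocus (pM (M.act (M.χ F))) LinearMap.id := by
        rw [Submodule.span_le]
        rintro _ ⟨g, rfl⟩
        rw [SetLike.mem_coe, LinearMap.mem_eqLocus]
        simp only [LinearMap.id_apply]
        have hq : M.q (M.χ F + g, pA) = M.q (g, pA) := by
          rw [M.q_eq]
          refine ⟨rfl, ?_⟩
          rw [add_assoc, Gp_add_self, add_zero]
          exact Submodule.subset_span ⟨F, (hp F).2 hF, rfl⟩
        rw [act_pt, pt, pt, hq]
      exact this (M.rX_span hp (M.mem_C.1 hx).1)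
    rw [rX_eig M hp hx] at h3
    have h4 : (chr ω (M.χ F) - 1) • (M.contr hp).rX x = 0 := by rw [sub_smul, h3, one_smul, sub_self]
    exact (smul_eq_zero.1 h4).resolve_left (sub_ne_zero.2 hs)
  rw [Submodule.mem_bot, sub_eq_zero]
  rwa [h2, add_zero] at h1

theorem star_pos {ω : Gp n} (hs : ∀ F ∈ A, chr ω (M.χ F) = 1) {x0 : P} (hx0 : ∀ F, M.ℓ F x0 ≠ 0) :
    Gen (M.C ω A) (M.e ω (M.pt 0 x0)) := by
  have hxU : x0 ∈ M.U A := fun F _ => hx0 F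
  have hpU := M.pA_mem hp
  have hrz : (M.contr hp).rX (M.e ω (M.pt 0 x0)) = M.e ω (M.pt 0 pA) := by
    rw [e_apply, e_apply, map_smul, map_sum]
    congr 1
    refine Finset.sum_congr rfl fun g _ => ?_
    rw [map_smul, act_pt, act_pt, rX_pt _ _ _ hxU]
  have hzC : M.e ω (M.pt 0 x0) ∈ M.C ω A := M.e_mem ω (M.pt_mem 0 hxU)
  have hdz : dM (M.e ω (M.pt 0 x0)) = 0 := by rw [d_e, d_pt, map_zero]
  refine ⟨hzC, hdz, fun x hx hd => ?_, fun y hy hyz => ?_⟩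
  · have h1 := M.star_eq hp hx hd
    have h2 : ∃ c : ℚ, (M.contr hp).rX x = c • M.e ω (M.pt 0 pA) := by
      rw [← M.e_fix (M.rX_eig hp hx)]
      have : Submodule.span ℚ (Set.range fun g => M.pt g pA) ≤
          (Submodule.span ℚ {M.e ω (M.pt 0 pA)}).comap (M.e ω) := by
        rw [Submodule.span_le]
        rintro _ ⟨g, rfl⟩
        rw [SetLike.mem_coe, Submodule.mem_comap]
        have := M.e_pt ω g pA
        simp only [this]
        exact Submodule.smul_mem _ _ (Submodule.mem_span_singleton_self _)
      obtain ⟨c, hc⟩ := Submodule.mem_span_singleton.1 (this (M.rX_span hp (M.mem_C.1 hx).1))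
      exact ⟨c, hc.symm⟩
    obtain ⟨c, hc⟩ := h2
    have h3 := M.star_eq hp hzC hdz
    rw [hrz] at h3
    refine ⟨(M.contr hp).coneX x - c • (M.contr hp).coneX (M.e ω (M.pt 0 x0)),
      Submodule.sub_mem _ (M.cone_C hp hx) (Submodule.smul_mem _ _ (M.cone_C hp hzC)), c, ?_⟩
    rw [map_sub, map_smul]
    nth_rewrite 1 [h1]
    rw [hc]
    nth_rewrite 2 [h3]
    rw [smul_add]; abel
  · have h1 := Contr.rX_d (M.contr hp) (M.mem_C.1 hy).1
    rw [hyz, hrz, e_apply, smul_eq_zero] at h1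
    have h2 := h1.resolve_left (by positivity)
    have h3 := congrArg (fun f : Ch X => f ⟨0, ContinuousMap.const _ (M.q (0, pA))⟩) h2
    simp only [act_pt, add_zero] at h3
    rw [Finsupp.finsetSum_apply] at h3
    have h4 : ∀ g : Gp n, 0 ≤ (chr ω g • M.pt g pA) ⟨0, ContinuousMap.const _ (M.q (0, pA))⟩ := by
      intro g
      rw [Finsupp.smul_apply, pt]
      by_cases hg : M.q (g, pA) = M.q (0, pA)
      · rw [hg]
        have hg2 := ((M.q_eq _ _ _ _).1 hg).2
        rw [add_zero] at hg2
        have key : ∀ g ∈ M.H pA, chr ω g = 1 := by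
          intro g hg
          induction hg using Submodule.span_induction with
          | mem x h => obtain ⟨F, hF, rfl⟩ := h; exact hs F ((hp F).1 hF)
          | zero => exact chr_zero ω
          | add x y _ _ hx hy => rw [chr_add, hx, hy, one_mul]
          | smul a x _ hx =>
            have : ∀ a : ZMod 2, a = 0 ∨ a = 1 := by decide
            rcases this a with rfl | rfl
            · rw [zero_smul, chr_zero]
            · rw [one_smul, hx]
        simp [key g hg2]
      · classical
        rw [Finsupp.single_apply, if_neg, smul_zero]
        intro hh
        have hh2 := congrArg (fun s : Sg X => M.q (0, pA) ∈ Set.range s.2) hh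
        have h6 : M.q (0, pA) ∈ Set.range (ContinuousMap.const (E (0 + 1)) (M.q (g, pA))) := by
          rw [hh2]; exact ⟨unif 0, rfl⟩
        obtain ⟨y, hy⟩ := h6
        exact hg hy
    have h5 := (Finset.sum_eq_zero_iff_of_nonneg fun g _ => h4 g).1 h3 0 (Finset.mem_univ _)
    simp [pt, chr_zero] at h5

end star

end Mir
end PC
end

open Complex CategoryTheory

noncomputable section

namespace PC

set_option linter.unusedSectionVars false
set_option linter.unusedVariables false

section
variable {X : Type} [TopologicalSpace X]

/-- homology type: acyclic or a sphere -/
def HT (A : Submodule ℚ (Ch X)) : Option ℕ → Prop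
  | none => Acyc A ⊥
  | some k => Sph A k

theorem HT.of_acyc {A B : Submodule ℚ (Ch X)} {o : Option ℕ} (hAB : A ≤ B) (h : Acyc B A)
    (hA : HT A o) : HT B o := by
  cases o with
  | none => exact Acyc.bot_of_acyc hAB h hA
  | some k => exact Sph.of_acyc hAB h hA

theorem HT.susp {A1 A2 : Submodule ℚ (Ch X)} {o : Option ℕ} (hs1 : St A1) (hs2 : St A2)
    (h1 : HT A1 none) (h2 : HT A2 none) (h : HT (A1 ⊓ A2) o) : HT (A1 ⊔ A2) (o.map (· + 1)) := by
  cases o with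
  | none => exact Acyc.sup_bot hs1 hs2 h1 h2 h
  | some k => exact Sph.susp hs1 hs2 h1 h2 h
end

namespace Mir

variable {n : ℕ} {P 𝓕 X : Type} [TopologicalSpace P] [TopologicalSpace X]
  (M : Mir n P 𝓕 X) [DecidableEq 𝓕] [T1Space P] [Finite 𝓕]

theorem sup_le_C (ω : Gp n) (A : Finset 𝓕) (F1 F2 : 𝓕) :
    M.C ω (A.erase F1) ⊔ M.C ω (A.erase F2) ≤ M.C ω A :=
  sup_le (M.C_mono ω (Finset.erase_subset _ _)) (M.C_mono ω (Finset.erase_subset _ _))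

theorem pos_erase (hr : ∀ F, M.compat F F) (ω : Gp n) (A : Finset 𝓕) (F : 𝓕) (hF : F ∈ A)
    (hs : chr ω (M.χ F) = 1) : Acyc (M.C ω A) (M.C ω (A.erase F)) := by
  induction A using Finset.strongInduction with
  | H A ih =>
  by_cases hcl : ∀ F ∈ A, ∀ F' ∈ A, M.compat F F'
  · obtain ⟨p, hp⟩ := M.flag A hcl
    obtain ⟨p', hp'⟩ := M.flag (A.erase F) fun a ha b hb =>
      hcl a (Finset.mem_of_mem_erase ha) b (Finset.mem_of_mem_erase hb)
    by_cases hn : ∃ F' ∈ A, chr ω (M.χ F') ≠ 1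
    · obtain ⟨F', hF', hn⟩ := hn
      refine Acyc.of_acyclic (M.C_St _ _) (M.C_mono ω (Finset.erase_subset _ _))
        (M.star_neg hp hF' hn) (M.star_neg hp' (F := F') ?_ hn)
      refine Finset.mem_erase.2 ⟨?_, hF'⟩
      rintro rfl; exact hn hs
    · push Not at hn
      obtain ⟨x0, hx0⟩ := M.flag ∅ (by simp)
      have hx0 : ∀ F, M.ℓ F x0 ≠ 0 := fun F h => by simpa using (hx0 F).1 h
      exact Acyc.of_gen (M.C_St _ _) (M.C_mono ω (Finset.erase_subset _ _))
        (M.star_pos hp hn hx0)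
        (M.star_pos hp' (fun G hG => hn G (Finset.mem_of_mem_erase hG)) hx0)
  · by_cases h2 : ∃ F2 ∈ A, ¬ M.compat F F2
    · obtain ⟨F2, hF2, hc⟩ := h2
      have hne : F ≠ F2 := by rintro rfl; exact hc (hr _)
      have h1 := ih (A.erase F2) (Finset.erase_ssubset hF2) (Finset.mem_erase.2 ⟨hne, hF⟩)
      have h3 : Acyc (M.C ω (A.erase F2)) (M.C ω (A.erase F2) ⊓ M.C ω (A.erase F)) := by
        rw [M.C_erase]; exact h1
      have h4 := Acyc.second (M.C_St _ _) (M.C_St _ _) h3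
      have h5 := M.small ω A hc
      rw [sup_comm] at h5
      refine Acyc.trans ?_ le_sup_right h5 h4
      exact M.sup_le_C _ _ _ _
    · push Not at h2 hcl
      obtain ⟨F1, hF1, F2, hF2, hc⟩ := hcl
      have hne : F1 ≠ F2 := by rintro rfl; exact hc (hr _)
      have n1 : F ≠ F1 := by rintro rfl; exact hc (h2 _ hF2)
      have n2 : F ≠ F2 := by rintro rfl; exact hc (M.compat_symm _ _ (h2 _ hF1))
      have i1 := ih (A.erase F1) (Finset.erase_ssubset hF1) (Finset.mem_erase.2 ⟨n1, hF⟩)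
      have i2 := ih (A.erase F2) (Finset.erase_ssubset hF2) (Finset.mem_erase.2 ⟨n2, hF⟩)
      have i12 := ih ((A.erase F1).erase F2)
        ((Finset.erase_ssubset (Finset.mem_erase.2 ⟨hne.symm, hF2⟩)).trans
          (Finset.erase_ssubset hF1))
        (Finset.mem_erase.2 ⟨n2, Finset.mem_erase.2 ⟨n1, hF⟩⟩)
      have e1 : (A.erase F1).erase F = (A.erase F).erase F1 := Finset.erase_right_comm
      have e2 : (A.erase F2).erase F = (A.erase F).erase F2 := Finset.erase_right_comm
      have e12 : ((A.erase F1).erase F2).erase F = ((A.erase F).erase F1).erase F2 := by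
        rw [Finset.erase_right_comm, e1]
      rw [e1] at i1
      rw [e2] at i2
      rw [e12, ← M.C_erase, ← M.C_erase] at i12
      have h5 := Acyc.five (M.C_St _ _) (M.C_St _ _) (M.C_St _ _) (M.C_St _ _)
        (M.C_mono ω (by rw [← e1]; exact Finset.erase_subset _ _))
        (M.C_mono ω (by rw [← e2]; exact Finset.erase_subset _ _)) i1 i2 i12
      have h6 := M.small ω A hc
      have h7 := M.small ω (A.erase F) hc
      have h8 := Acyc.trans (M.sup_le_C _ _ _ _) (sup_le_sup
        (M.C_mono ω (by rw [← e1]; exact Finset.erase_subset _ _))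
        (M.C_mono ω (by rw [← e2]; exact Finset.erase_subset _ _))) h6 h5
      exact Acyc.top (M.sup_le_C _ _ _ _) (M.C_mono ω (Finset.erase_subset _ _)) h8 h7

theorem HT_sdiff (hr : ∀ F, M.compat F F) (ω : Gp n) (o : Option ℕ) (D : Finset 𝓕) :
    ∀ A : Finset 𝓕, D ⊆ A → (∀ F ∈ D, chr ω (M.χ F) = 1) → HT (M.C ω (A \ D)) o →
      HT (M.C ω A) o := by
  induction D using Finset.induction_on with
  | empty => intro A _ _ h; simpa using h
  | insert F D hFD ih =>
    intro A hA hs h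
    have hFA : F ∈ A := hA (Finset.mem_insert_self _ _)
    refine ih A (fun x hx => hA (Finset.mem_insert_of_mem hx))
      (fun G hG => hs G (Finset.mem_insert_of_mem hG)) ?_
    refine HT.of_acyc ?_ (M.pos_erase hr ω (A \ D) F (Finset.mem_sdiff.2 ⟨hFA, hFD⟩)
      (hs F (Finset.mem_insert_self _ _))) ?_
    · exact M.C_mono ω (Finset.erase_subset _ _)
    · rwa [← Finset.sdiff_insert]

theorem neg_cone (hr : ∀ F, M.compat F F) (ω : Gp n) (A : Finset 𝓕) (F : 𝓕) (hF : F ∈ A)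
    (hs : chr ω (M.χ F) ≠ 1) (hc : ∀ F' ∈ A, M.compat F F') : HT (M.C ω A) none := by
  induction A using Finset.strongInduction with
  | H A ih =>
  by_cases hcl : ∀ F ∈ A, ∀ F' ∈ A, M.compat F F'
  · obtain ⟨p, hp⟩ := M.flag A hcl
    exact M.star_neg hp hF hs
  · push Not at hcl
    obtain ⟨F1, hF1, F2, hF2, hc'⟩ := hcl
    have hne : F1 ≠ F2 := by rintro rfl; exact hc' (hr _)
    have n1 : F ≠ F1 := by rintro rfl; exact hc' (hc _ hF2)
    have n2 : F ≠ F2 := by rintro rfl; exact hc' (M.compat_symm _ _ (hc _ hF1))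
    have i1 := ih (A.erase F1) (Finset.erase_ssubset hF1) (Finset.mem_erase.2 ⟨n1, hF⟩)
      fun G hG => hc G (Finset.mem_of_mem_erase hG)
    have i2 := ih (A.erase F2) (Finset.erase_ssubset hF2) (Finset.mem_erase.2 ⟨n2, hF⟩)
      fun G hG => hc G (Finset.mem_of_mem_erase hG)
    have i12 := ih ((A.erase F1).erase F2)
      ((Finset.erase_ssubset (Finset.mem_erase.2 ⟨hne.symm, hF2⟩)).trans
        (Finset.erase_ssubset hF1))
      (Finset.mem_erase.2 ⟨n2, Finset.mem_erase.2 ⟨n1, hF⟩⟩)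
      fun G hG => hc G (Finset.mem_of_mem_erase (Finset.mem_of_mem_erase hG))
    rw [← M.C_erase] at i12
    exact HT.of_acyc (M.sup_le_C _ _ _ _) (M.small ω A hc')
      (HT.susp (o := none) (M.C_St _ _) (M.C_St _ _) i1 i2 i12)

theorem HT_split (ω : Gp n) (A : Finset 𝓕) (F1 F2 : 𝓕) (hc : ¬ M.compat F1 F2) {o : Option ℕ}
    (h1 : HT (M.C ω (A.erase F1)) none) (h2 : HT (M.C ω (A.erase F2)) none)
    (h12 : HT (M.C ω ((A.erase F1).erase F2)) o) : HT (M.C ω A) (o.map (· + 1)) := by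
  rw [← M.C_erase] at h12
  exact HT.of_acyc (M.sup_le_C _ _ _ _) (M.small ω A hc)
    (HT.susp (M.C_St _ _) (M.C_St _ _) h1 h2 h12)

theorem HT_elim (ω : Gp n) (A : Finset 𝓕) (F1 F2 : 𝓕) (hc : ¬ M.compat F1 F2) {o : Option ℕ}
    (h1 : HT (M.C ω (A.erase F2)) none) (h12 : HT (M.C ω ((A.erase F2).erase F1)) none)
    (h2 : HT (M.C ω (A.erase F1)) o) : HT (M.C ω A) o := by
  have h3 : Acyc (M.C ω (A.erase F2)) (M.C ω (A.erase F2) ⊓ M.C ω (A.erase F1)) := by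
    rw [M.C_erase]
    exact Acyc.of_acyclic (M.C_St _ _) (M.C_mono ω (Finset.erase_subset _ _)) h1 h12
  have h4 := Acyc.second (M.C_St _ _) (M.C_St _ _) h3
  have h5 := M.small ω A hc
  rw [sup_comm] at h5
  exact HT.of_acyc (M.C_mono ω (Finset.erase_subset _ _))
    (Acyc.trans (M.sup_le_C _ _ _ _) le_sup_right h5 h4) h2

theorem HT_empty (ω : Gp n) : HT (M.C ω ∅) (some 0) := by
  obtain ⟨x0, hx0⟩ := M.flag ∅ (by simp)
  have hx0' : ∀ F, M.ℓ F x0 ≠ 0 := fun F h => by simpa using (hx0 F).1 h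
  obtain ⟨h1, h2, h3, h4⟩ := M.star_pos (ω := ω) hx0 (by simp) hx0'
  refine ⟨_, h1, ?_, h2, h3, h4⟩
  rw [pr_e, pt, pr_sg]; simp

end Mir

section cube
variable {n m : ℕ}

abbrev Fc (m : ℕ) : Type := Fin 5 ⊕ (Fin m × Bool)

def adj5 (a b : Fin 5) : Prop := a = b ∨ a + 1 = b ∨ b + 1 = a

instance : DecidableRel adj5 := fun a b => by unfold adj5; infer_instance

def cmp {m : ℕ} : Fc m → Fc m → Prop
  | .inl a, .inl b => adj5 a b
  | .inr (i, s), .inr (j, t) => i = j → s = t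
  | _, _ => True

variable {P X : Type} [TopologicalSpace P] [TopologicalSpace X] [T1Space P]
  (M : Mir n P (Fc m) X) (hM : M.compat = cmp) (ω : Gp n)

theorem cmp_refl (F : Fc m) : cmp F F := by
  rcases F with a | ⟨i, s⟩ <;> simp [cmp, adj5]

def BS (T : Finset (Fin 5)) (S : Finset (Fin m)) : Finset (Fc m) :=
  T.disjSum (S ×ˢ Finset.univ)

theorem BS_erase (T : Finset (Fin 5)) (S : Finset (Fin m)) (k : Fin 5) :
    (BS T S).erase (.inl k) = BS (T.erase k) S := by
  ext F; rcases F with a | ⟨i, s⟩ <;> simp [BS]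

theorem HT_cube (T : Finset (Fin 5)) (S : Finset (Fin m)) (hM : M.compat = cmp)
    (hn : ∀ i ∈ S, ∀ s, chr ω (M.χ (.inr (i, s))) ≠ 1) {o : Option ℕ}
    (h : HT (M.C ω (BS T ∅)) o) : HT (M.C ω (BS T S)) (o.map (· + S.card)) := by
  have hr : ∀ F, M.compat F F := by rw [hM]; exact cmp_refl
  induction S using Finset.induction_on with
  | empty => simpa using h
  | insert i S hi ih =>
    have ih := ih fun i h => hn i (Finset.mem_insert_of_mem h)
    have e1 : ((BS T (insert i S)).erase (.inr (i, true))).erase (.inr (i, false)) = BS T S := by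
      ext F; rcases F with a | ⟨j, s⟩ 
      · simp [BS]
      · cases s <;> simp [BS] <;> grind
    have e2 : o.map (· + (insert i S).card) = (o.map (· + S.card)).map (· + 1) := by
      rw [Option.map_map, Finset.card_insert_of_notMem hi]; rfl
    have key : ∀ s, HT (M.C ω ((BS T (insert i S)).erase (.inr (i, s)))) none := by
      intro s
      refine M.neg_cone hr ω _ (.inr (i, !s)) (by simp [BS]) (hn i (Finset.mem_insert_self _ _) _) ?_
      intro F hF
      rw [hM]
      rcases F with a | ⟨j, t⟩
      · trivial
      · simp only [cmp]
        rintro rfl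
        cases s <;> cases t <;> simp_all [BS]
    rw [e2]
    refine M.HT_split ω _ (.inr (i, true)) (.inr (i, false)) ?_ (key _) (key _) ?_
    · rw [hM]; simp [cmp]
    · rw [e1]; exact ih

theorem P_cone (hM : M.compat = cmp) (T : Finset (Fin 5)) (k : Fin 5)
    (hT : ∀ k ∈ T, chr ω (M.χ (.inl k)) ≠ 1) (hk : k ∈ T) (hc : ∀ j ∈ T, adj5 k j) :
    HT (M.C ω (BS T ∅)) none := by
  have hr : ∀ F, M.compat F F := by rw [hM]; exact cmp_refl
  refine M.neg_cone hr ω _ (.inl k) (by simp [BS, hk]) (hT k hk) ?_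
  intro F hF
  rw [hM]
  rcases F with a | ⟨j, t⟩
  · exact hc a (by simpa [BS] using hF)
  · trivial

theorem P_split (hM : M.compat = cmp) (T : Finset (Fin 5)) (a b : Fin 5) (hab : ¬ adj5 a b)
    {o : Option ℕ} (h1 : HT (M.C ω (BS (T.erase a) ∅)) none)
    (h2 : HT (M.C ω (BS (T.erase b) ∅)) none)
    (h12 : HT (M.C ω (BS ((T.erase a).erase b) ∅)) o) :
    HT (M.C ω (BS T ∅)) (o.map (· + 1)) := by
  refine M.HT_split ω _ (.inl a) (.inl b) (by rw [hM]; exact hab) ?_ ?_ ?_ <;>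
    simpa only [BS_erase]

theorem P_elim (hM : M.compat = cmp) (T : Finset (Fin 5)) (a b : Fin 5) (hab : ¬ adj5 a b)
    {o : Option ℕ} (h1 : HT (M.C ω (BS (T.erase b) ∅)) none)
    (h12 : HT (M.C ω (BS ((T.erase b).erase a) ∅)) none)
    (h2 : HT (M.C ω (BS (T.erase a) ∅)) o) :
    HT (M.C ω (BS T ∅)) o := by
  refine M.HT_elim ω _ (.inl a) (.inl b) (by rw [hM]; exact hab) ?_ ?_ ?_ <;>
    simpa only [BS_erase]

theorem P_pair (hM : M.compat = cmp) (a b : Fin 5) (hab : ¬ adj5 a b)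
    (hT : ∀ k ∈ ({a, b} : Finset (Fin 5)), chr ω (M.χ (.inl k)) ≠ 1) :
    HT (M.C ω (BS {a, b} ∅)) (some 1) := by
  have hne : a ≠ b := by rintro rfl; exact hab (Or.inl rfl)
  have e1 : ({a, b} : Finset (Fin 5)).erase a = {b} := by grind
  have e2 : ({a, b} : Finset (Fin 5)).erase b = {a} := by grind
  refine P_split M ω hM _ a b hab (o := some 0) ?_ ?_ ?_
  · rw [e1]; exact P_cone M ω hM _ b (by simp at hT ⊢; exact hT.2) (by simp) (by simp [adj5])
  · rw [e2]; exact P_cone M ω hM _ a (by simp at hT ⊢; exact hT.1) (by simp) (by simp [adj5])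
  · rw [e1, Finset.erase_singleton]
    have : BS (m := m) ∅ ∅ = ∅ := by simp [BS]
    rw [this]; exact M.HT_empty ω

/-- type of the base subset -/
theorem P_none (hM : M.compat = cmp) : HT (M.C ω (BS ∅ ∅)) (some 0) := by
  have : BS (m := m) ∅ ∅ = ∅ := by simp [BS]
  rw [this]; exact M.HT_empty ω

theorem P_one (hM : M.compat = cmp) (hT : ∀ k ∈ ({4} : Finset (Fin 5)), chr ω (M.χ (.inl k)) ≠ 1) :
    HT (M.C ω (BS {4} ∅)) none :=
  P_cone M ω hM _ 4 hT (by decide) (by decide)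

theorem P_024 (hM : M.compat = cmp)
    (hT : ∀ k ∈ ({0, 2, 4} : Finset (Fin 5)), chr ω (M.χ (.inl k)) ≠ 1) :
    HT (M.C ω (BS {0, 2, 4} ∅)) (some 1) := by
  have sub : ∀ T : Finset (Fin 5), T ⊆ {0, 2, 4} → ∀ k ∈ T, chr ω (M.χ (.inl k)) ≠ 1 :=
    fun T h k hk => hT k (h hk)
  refine P_elim M ω hM _ 0 2 (by decide) ?_ ?_ ?_
  · exact P_cone M ω hM _ 4 (sub _ (by decide)) (by decide) (by decide)
  · exact P_cone M ω hM _ 4 (sub _ (by decide)) (by decide) (by decide)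
  · rw [show ({0, 2, 4} : Finset (Fin 5)).erase 0 = {2, 4} by decide]
    exact P_pair M ω hM 2 4 (by decide) (sub _ (by decide))

theorem P_134 (hM : M.compat = cmp)
    (hT : ∀ k ∈ ({1, 3, 4} : Finset (Fin 5)), chr ω (M.χ (.inl k)) ≠ 1) :
    HT (M.C ω (BS {1, 3, 4} ∅)) (some 1) := by
  have sub : ∀ T : Finset (Fin 5), T ⊆ {1, 3, 4} → ∀ k ∈ T, chr ω (M.χ (.inl k)) ≠ 1 :=
    fun T h k hk => hT k (h hk)
  refine P_elim M ω hM _ 3 1 (by decide) ?_ ?_ ?_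
  · exact P_cone M ω hM _ 4 (sub _ (by decide)) (by decide) (by decide)
  · exact P_cone M ω hM _ 4 (sub _ (by decide)) (by decide) (by decide)
  · rw [show ({1, 3, 4} : Finset (Fin 5)).erase 3 = {1, 4} by decide]
    exact P_pair M ω hM 1 4 (by decide) (sub _ (by decide))

theorem P_path (hM : M.compat = cmp) (a : Fin 5)
    (hT : ∀ k ∈ ({a, a + 1, a + 2, a + 3} : Finset (Fin 5)), chr ω (M.χ (.inl k)) ≠ 1) :
    HT (M.C ω (BS {a, a + 1, a + 2, a + 3} ∅)) none := by
  have sub : ∀ T : Finset (Fin 5), T ⊆ {a, a + 1, a + 2, a + 3} →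
    ∀ k ∈ T, chr ω (M.χ (.inl k)) ≠ 1 :=
    fun T h k hk => hT k (h hk)
  refine P_split M ω hM _ a (a + 3) (by clear hT sub; revert a; decide) (o := none) ?_ ?_ ?_
  · exact P_cone M ω hM _ (a + 2) (sub _ (by clear hT sub; revert a; decide)) (by clear hT sub; revert a; decide) (by clear hT sub; revert a; decide)
  · exact P_cone M ω hM _ (a + 1) (sub _ (by clear hT sub; revert a; decide)) (by clear hT sub; revert a; decide) (by clear hT sub; revert a; decide)
  · exact P_cone M ω hM _ (a + 1) (sub _ (by clear hT sub; revert a; decide)) (by clear hT sub; revert a; decide) (by clear hT sub; revert a; decide)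

theorem P_all (hM : M.compat = cmp)
    (hT : ∀ k, chr ω (M.χ (.inl k)) ≠ 1) :
    HT (M.C ω (BS Finset.univ ∅)) (some 2) := by
  refine P_split M ω hM _ 0 2 (by decide) (o := some 1) ?_ ?_ ?_
  · exact P_path M ω hM 1 (fun k _ => hT k)
  · have := P_path M ω hM 3 (fun k _ => hT k)
    rwa [show ({3, 3 + 1, 3 + 2, 3 + 3} : Finset (Fin 5)) = Finset.univ.erase 2 by decide] at this
  · exact P_134 M ω hM (fun k _ => hT k)

end cube

end PC

end

open Complex CategoryTheory

noncomputable section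

namespace PC

theorem z2 (a : ZMod 2) : a = 0 ∨ a = 1 := by revert a; decide

theorem sg2_ne {a : ZMod 2} : sg2 a ≠ 1 ↔ a ≠ 0 := by
  rcases z2 a with rfl | rfl <;> norm_num [sg2]

theorem sum_eVec {n : ℕ} (ω : Gp n) (k : Fin n) : ∑ j, ω j * eVec n k j = ω k := by
  rw [Finset.sum_eq_single k]
  · simp [eVec]
  · intro j _ hj
    have : (j : ℕ) ≠ k := fun h => hj (Fin.ext h)
    simp [eVec, this]
  · simp

theorem chr_eVec {n : ℕ} (ω : Gp n) (k : Fin n) : chr ω (eVec n k) ≠ 1 ↔ ω k ≠ 0 := by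
  rw [chr, sum_eVec, sg2_ne]

/-- the three data of a character -/
def Φ (m : ℕ) : Gp (m + 2) ≃ Finset (Fin m) × (ZMod 2 × ZMod 2) where
  toFun ω := (Finset.univ.filter fun i : Fin m => ω i.castSucc.castSucc ≠ 0,
    ω (Fin.last m).castSucc, ω (Fin.last (m + 1)))
  invFun p := Fin.snoc (α := fun _ => ZMod 2) (Fin.snoc (α := fun _ => ZMod 2)
    (fun i : Fin m => if i ∈ p.1 then (1 : ZMod 2) else 0) p.2.1) p.2.2
  left_inv ω := by
    funext i
    induction i using Fin.lastCases with
    | last => simp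
    | cast i =>
      induction i using Fin.lastCases with
      | last => simp
      | cast i =>
        simp only [Fin.snoc_castSucc, Finset.mem_filter, Finset.mem_univ, true_and]
        rcases z2 (ω i.castSucc.castSucc) with h | h <;> simp [h]
  right_inv p := by
    obtain ⟨S, a, b⟩ := p
    refine Prod.ext ?_ (Prod.ext ?_ ?_)
    · ext i; simp
    · simp
    · simp

def dg {m : ℕ} (p : Finset (Fin m) × (ZMod 2 × ZMod 2)) : Option ℕ :=
  if p.2.1 = 0 ∧ p.2.2 = 0 then (if Even p.1.card then some p.1.card else none)
  else if p.2.1 ≠ 0 ∧ p.2.2 ≠ 0 then (if Even p.1.card then none else some (p.1.card + 2))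
  else some (p.1.card + 1)

theorem sum_ω {m : ℕ} (ω : Gp (m + 2)) :
    ∑ j, ω j = ((Φ m ω).1.card : ZMod 2) + (Φ m ω).2.1 + (Φ m ω).2.2 := by
  rw [Fin.sum_univ_castSucc, Fin.sum_univ_castSucc]
  simp only [Φ, Equiv.coe_fn_mk]
  congr 2
  rw [Finset.card_eq_sum_ones, Nat.cast_sum, Finset.sum_filter]
  refine Finset.sum_congr rfl fun i _ => ?_
  rcases z2 (ω i.castSucc.castSucc) with h | h <;> simp [h]

def Tset (b1 b2 b3 : ZMod 2) : Finset (Fin 5) :=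
  Finset.univ.filter fun k => ![b1, b2, b1, b2, b3] k ≠ 0

variable {m : ℕ} {P X : Type} [TopologicalSpace P] [TopologicalSpace X] [T1Space P]
  (M : Mir (m + 2) P (Fc m) X)

theorem HT_univ (hM : M.compat = cmp) (h1 : ∀ k, M.χ (.inl k) = pentEdgeVal (m + 2) k)
    (h2 : ∀ i s, M.χ (.inr (i, s)) = eVec (m + 2) (i : ℕ)) (ω : Gp (m + 2)) :
    HT (M.C ω Finset.univ) (dg (Φ m ω)) := by
  have hr : ∀ F, M.compat F F := by rw [hM]; exact cmp_refl
  set b1 := (Φ m ω).2.1 with hb1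
  set b2 := (Φ m ω).2.2 with hb2
  set S := (Φ m ω).1 with hS
  set b3 : ZMod 2 := (S.card : ZMod 2) + b1 + b2 with hb3
  have c1 : ∀ k, chr ω (M.χ (.inl k)) ≠ 1 ↔ k ∈ Tset b1 b2 b3 := by
    intro k
    rw [h1, Tset, Finset.mem_filter]
    simp only [Finset.mem_univ, true_and]
    have e1 := chr_eVec ω (Fin.last m).castSucc
    have e2 := chr_eVec ω (Fin.last (m + 1))
    simp only [Fin.val_castSucc, Fin.val_last] at e1 e2
    have e3 : chr ω (fun _ => 1) ≠ 1 ↔ b3 ≠ 0 := by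
      rw [chr, hb3, hS, hb1, hb2, ← sum_ω, sg2_ne]; simp
    fin_cases k
    · exact e1
    · exact e2
    · exact e1
    · exact e2
    · exact e3
  have c2 : ∀ i s, chr ω (M.χ (.inr (i, s))) ≠ 1 ↔ i ∈ S := by
    intro i s
    rw [h2]
    have e1 := chr_eVec ω i.castSucc.castSucc
    simp only [Fin.val_castSucc] at e1
    rw [e1, hS]; simp [Φ]
  have key : ∀ o, HT (M.C ω (BS (Tset b1 b2 b3) ∅)) o →
      HT (M.C ω Finset.univ) (o.map (· + S.card)) := by
    intro o ho
    have := HT_cube M ω (Tset b1 b2 b3) S hM (fun i hi s => (c2 i s).2 hi) ho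
    refine M.HT_sdiff hr ω _ (Finset.univ.filter fun F => chr ω (M.χ F) = 1) _
      (Finset.subset_univ _) (by simp) ?_
    have e : (Finset.univ \ Finset.univ.filter fun F => chr ω (M.χ F) = 1) = BS (Tset b1 b2 b3) S := by
      ext F
      rcases F with k | ⟨i, s⟩
      · simpa [BS] using c1 k
      · simpa [BS] using c2 i s
    rw [e]; exact this
  have hT := fun k h => (c1 k).2 h
  clear_value b1 b2 S
  have hcard : (S.card : ZMod 2) = 0 ↔ Even S.card := by
    rw [ZMod.natCast_eq_zero_iff]; exact even_iff_two_dvd.symm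
  have hcard' : ¬ Even S.card → (S.card : ZMod 2) = 1 := fun h => by
    rcases z2 (S.card : ZMod 2) with h' | h'
    · exact absurd (hcard.1 h') h
    · exact h'
  have hdg : dg (Φ m ω) = dg (S, (b1, b2)) := by rw [hS, hb1, hb2]
  rw [hdg]
  by_cases hE : Even S.card
  · rw [hcard.2 hE] at hb3
    clear_value b3
    subst hb3
    rcases z2 b1 with r1 | r1 <;> rcases z2 b2 with r2 | r2 <;> rw [r1, r2] at hT key ⊢
    · rw [show Tset 0 0 (0 + 0 + 0) = ∅ by decide] at hT key
      simpa [dg, hE] using key _ (P_none M ω hM)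
    · rw [show Tset 0 1 (0 + 0 + 1) = {1, 3, 4} by decide] at hT key
      simpa [dg, hE, add_comm] using key _ (P_134 M ω hM hT)
    · rw [show Tset 1 0 (0 + 1 + 0) = {0, 2, 4} by decide] at hT key
      simpa [dg, hE, add_comm] using key _ (P_024 M ω hM hT)
    · rw [show Tset 1 1 (0 + 1 + 1) = {0, 0 + 1, 0 + 2, 0 + 3} by decide] at hT key
      simpa [dg, hE] using key _ (P_path M ω hM 0 hT)
  · rw [hcard' hE] at hb3
    clear_value b3
    subst hb3
    rcases z2 b1 with r1 | r1 <;> rcases z2 b2 with r2 | r2 <;> rw [r1, r2] at hT key ⊢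
    · rw [show Tset 0 0 (1 + 0 + 0) = {4} by decide] at hT key
      simpa [dg, hE] using key _ (P_one M ω hM hT)
    · rw [show Tset 0 1 (1 + 0 + 1) = {1, 3} by decide] at hT key
      simpa [dg, hE, add_comm] using key _ (P_pair M ω hM 1 3 (by decide) hT)
    · rw [show Tset 1 0 (1 + 1 + 0) = {0, 2} by decide] at hT key
      simpa [dg, hE, add_comm] using key _ (P_pair M ω hM 0 2 (by decide) hT)
    · rw [show Tset 1 1 (1 + 1 + 1) = Finset.univ by decide] at hT key
      simpa [dg, hE, add_comm] using key _ (P_all M ω hM fun k => hT k (Finset.mem_univ _))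

theorem count_card {m : ℕ} (k : ℕ) :
    (Finset.univ.filter fun S : Finset (Fin m) => S.card = k).card = m.choose k := by
  rw [← Finset.powerset_univ, ← Finset.powersetCard_eq_filter, Finset.card_powersetCard]; simp

theorem count (m i : ℕ) :
    Fintype.card {ω : Gp (m + 2) // dg (Φ m ω) = some i} =
      if Even i then 2 * chooseInt m ((i : ℤ) - 1) + m.choose i
      else 2 * chooseInt m ((i : ℤ) - 1) + chooseInt m ((i : ℤ) - 2) := by
  have e : Fintype.card {ω : Gp (m + 2) // dg (Φ m ω) = some i} =
      (Finset.univ.filter fun p : Finset (Fin m) × (ZMod 2 × ZMod 2) => dg p = some i).card := by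
    rw [← Fintype.card_subtype]
    exact Fintype.card_congr ((Φ m).subtypeEquiv fun ω => Iff.rfl)
  have z (f : ZMod 2 → ℕ) : ∑ a, f a = f 0 + f 1 := Fin.sum_univ_two f
  rw [e, Finset.card_filter, Fintype.sum_prod_type_right, Fintype.sum_prod_type]
  simp only [z, ← Finset.card_filter]
  have c1 : (Finset.univ.filter fun S : Finset (Fin m) => S.card + 1 = i).card =
      chooseInt m ((i : ℤ) - 1) := by
    rcases i with _ | i
    · simp [chooseInt]
    · simp [chooseInt, count_card]
  have c0 : (Finset.univ.filter fun S : Finset (Fin m) =>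
      (if Even S.card then some S.card else none) = some i).card = if Even i then m.choose i else 0 := by
    split_ifs with h
    · rw [← count_card]
      congr 1; ext S
      simp only [Finset.mem_filter, Finset.mem_univ, true_and]
      split_ifs with h' <;> simp
      rintro rfl; exact h' h
    · rw [Finset.card_eq_zero, Finset.filter_eq_empty_iff]
      intro S _
      split_ifs with h' <;> simp
      rintro rfl; exact h h'
  have c2 : (Finset.univ.filter fun S : Finset (Fin m) =>
      (if Even S.card then none else some (S.card + 2)) = some i).card =
      if Even i then 0 else chooseInt m ((i : ℤ) - 2) := by
    split_ifs with h
    · rw [Finset.card_eq_zero, Finset.filter_eq_empty_iff]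
      intro S _
      split_ifs with h' <;> simp
      rintro rfl; exact h' (by simpa [Nat.even_add] using h)
    · rcases i with _ | _ | i
      · simp at h
      · simp [chooseInt]
      · have : chooseInt m (((i + 1 + 1 : ℕ) : ℤ) - 2) = m.choose i := by
          have : (((i + 1 + 1 : ℕ) : ℤ) - 2) = i := by push_cast; ring
          rw [this]; simp [chooseInt]
        rw [this, ← count_card]
        congr 1; ext S
        simp only [Finset.mem_filter, Finset.mem_univ, true_and]
        split_ifs with h' <;> simp
        rintro rfl; exact h (by simpa [Nat.even_add] using h')
  simp only [dg]
  norm_num at c0 c2 ⊢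
  rw [c0, c1, c2]
  split_ifs <;> ring

end PC

end

open Complex CategoryTheory

noncomputable section

namespace PC

def lin (k : Fin 5) : ℂ →ₗ[ℝ] ℝ :=
  Real.cos (Real.pi * (2 * (k : ℕ) + 1) / 5) • Complex.reLm +
    Real.sin (Real.pi * (2 * (k : ℕ) + 1) / 5) • Complex.imLm

def ell (k : Fin 5) (z : ℂ) : ℝ := Real.cos (Real.pi / 5) - lin k z

theorem ell_cont (k : Fin 5) : Continuous (ell k) := by
  have : ell k = fun z => Real.cos (Real.pi / 5) - 
    (Real.cos (Real.pi * (2 * (k : ℕ) + 1) / 5) * z.re + Real.sin (Real.pi * (2 * (k : ℕ) + 1) / 5) * z.im) := by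
    funext z; simp [ell, lin]
  rw [this]; fun_prop

theorem pv_eq (j : ℕ) : pentVertex j = ⟨Real.cos (2 * Real.pi * j / 5), Real.sin (2 * Real.pi * j / 5)⟩ := by
  have : (2 * Real.pi * Complex.I * j / 5 : ℂ) = ((2 * Real.pi * j / 5 : ℝ) : ℂ) * Complex.I := by
    push_cast; ring
  rw [pentVertex, this]
  apply Complex.ext
  · rw [Complex.exp_ofReal_mul_I_re]
  · rw [Complex.exp_ofReal_mul_I_im]

theorem pv_five : pentVertex 5 = pentVertex 0 := by
  rw [pv_eq, pv_eq]
  have : 2 * Real.pi * ((5 : ℕ) : ℝ) / 5 = 2 * Real.pi := by push_cast; ring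
  rw [this]; simp

theorem pv_succ (k : Fin 5) : pentVertex ((k : ℕ) + 1) = pentVertex ((k + 1 : Fin 5) : ℕ) := by
  fin_cases k
  · rfl
  · rfl
  · rfl
  · rfl
  · exact pv_five

theorem ell_pv (k j : Fin 5) : ell k (pentVertex j) =
    2 * Real.sin (((j : ℕ) - (k : ℕ) : ℝ) * (Real.pi / 5)) *
      Real.sin (((j : ℕ) - (k : ℕ) - 1 : ℝ) * (Real.pi / 5)) := by
  have h1 : lin k (pentVertex j) =
      Real.cos ((2 * ((j : ℕ) - (k : ℕ) : ℝ) - 1) * (Real.pi / 5)) := by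
    rw [pv_eq]
    simp only [lin, LinearMap.add_apply, LinearMap.smul_apply, Complex.reLm_coe, Complex.imLm_coe, smul_eq_mul]
    rw [← Real.cos_sub, ← Real.cos_neg]; congr 1; ring
  rw [ell, h1]
  set a := ((j : ℕ) - (k : ℕ) : ℝ) * (Real.pi / 5) with ha
  have e1 : Real.pi / 5 = a - (((j : ℕ) - (k : ℕ) - 1 : ℝ) * (Real.pi / 5)) := by rw [ha]; ring
  have e2 : (2 * ((j : ℕ) - (k : ℕ) : ℝ) - 1) * (Real.pi / 5) = a + (((j : ℕ) - (k : ℕ) - 1 : ℝ) * (Real.pi / 5)) := by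
    rw [ha]; ring
  rw [e2]
  have e3 : Real.cos (Real.pi / 5) = Real.cos (a - (((j : ℕ) - (k : ℕ) - 1 : ℝ) * (Real.pi / 5))) :=
    congrArg _ e1
  rw [e3, Real.cos_add, Real.cos_sub]; ring

theorem sin_pos' (d : ℝ) (h1 : 0 < d) (h2 : d < 5) : 0 < Real.sin (d * (Real.pi / 5)) := by
  have := Real.pi_pos
  apply Real.sin_pos_of_pos_of_lt_pi
  · positivity
  · nlinarith

theorem sin_neg' (d : ℝ) (h1 : d < 0) (h2 : -5 < d) : Real.sin (d * (Real.pi / 5)) < 0 := by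
  have := sin_pos' (-d) (by linarith) (by linarith)
  rw [neg_mul, Real.sin_neg] at this; linarith

theorem ell_pv_zero (k j : Fin 5) (h : j = k ∨ j = k + 1) : ell k (pentVertex j) = 0 := by
  rw [ell_pv]
  rcases h with rfl | rfl
  · simp
  · by_cases hk : k = 4
    · subst hk
      have : ((((4 + 1 : Fin 5) : ℕ) : ℝ) - ((4 : Fin 5) : ℕ) - 1) * (Real.pi / 5) = - Real.pi := by
        rw [show ((4 + 1 : Fin 5) : ℕ) = 0 from rfl, show ((4 : Fin 5) : ℕ) = 4 from rfl]
        push_cast; ring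
      rw [this]; simp
    · have : ((k + 1 : Fin 5) : ℕ) = (k : ℕ) + 1 := by revert k; decide
      rw [this]; push_cast; simp

theorem ell_pv_pos (k j : Fin 5) (h : ¬ (j = k ∨ j = k + 1)) : 0 < ell k (pentVertex j) := by
  rw [ell_pv, mul_assoc]
  refine mul_pos two_pos ?_
  have hk : ((k : ℕ) : ℝ) ≤ 4 := by exact_mod_cast Nat.lt_succ_iff.1 k.2
  have hj : ((j : ℕ) : ℝ) ≤ 4 := by exact_mod_cast Nat.lt_succ_iff.1 j.2
  have hk0 : (0 : ℝ) ≤ (k : ℕ) := Nat.cast_nonneg _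
  have hj0 : (0 : ℝ) ≤ (j : ℕ) := Nat.cast_nonneg _
  have : (k : ℕ) + 2 ≤ j ∨ ((j : ℕ) + 1 ≤ k ∧ (k : ℕ) ≤ j + 3) := by clear hk hj hk0 hj0; revert k j; decide
  rcases this with h | ⟨h, h'⟩
  · have h : ((k : ℕ) : ℝ) + 2 ≤ (j : ℕ) := by exact_mod_cast h
    exact mul_pos (sin_pos' _ (by linarith) (by linarith)) (sin_pos' _ (by linarith) (by linarith))
  · have h : ((j : ℕ) : ℝ) + 1 ≤ (k : ℕ) := by exact_mod_cast h
    have h' : ((k : ℕ) : ℝ) ≤ (j : ℕ) + 3 := by exact_mod_cast h'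
    exact mul_pos_of_neg_of_neg (sin_neg' _ (by linarith) (by linarith)) (sin_neg' _ (by linarith) (by linarith))

theorem ell_pv_iff (k j : Fin 5) : ell k (pentVertex j) = 0 ↔ j = k ∨ j = k + 1 :=
  ⟨fun h => by_contra fun h' => (ell_pv_pos k j h').ne' h, ell_pv_zero k j⟩

theorem ell_pv_nonneg (k j : Fin 5) : 0 ≤ ell k (pentVertex j) := by
  by_cases h : j = k ∨ j = k + 1
  · rw [ell_pv_zero k j h]
  · exact (ell_pv_pos k j h).le

theorem pent_mem (z : ℂ) : z ∈ Pentagon ↔ ∃ w ∈ stdSimplex ℝ (Fin 5),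
    ∑ j, w j • pentVertex (j : Fin 5) = z := by
  have h : Pentagon = (Fintype.linearCombination ℝ (fun k : Fin 5 => pentVertex k)) '' stdSimplex ℝ (Fin 5) := by
    rw [← convexHull_rangle_single_eq_stdSimplex, LinearMap.image_convexHull, ← Set.range_comp]
    rw [Pentagon]; congr 2
    funext k
    simp [Fintype.linearCombination_apply_single]
  rw [h]; rfl

theorem ell_sum (k : Fin 5) (w : Fin 5 → ℝ) (hw : w ∈ stdSimplex ℝ (Fin 5)) :
    ell k (∑ j, w j • pentVertex (j : Fin 5)) = ∑ j : Fin 5, w j * ell k (pentVertex j) := by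
  simp only [ell, map_sum, map_smul, smul_eq_mul, mul_sub, Finset.sum_sub_distrib, ← Finset.sum_mul, hw.2, one_mul]

theorem ell_sum_zero (k : Fin 5) (w : Fin 5 → ℝ) (hw : w ∈ stdSimplex ℝ (Fin 5)) :
    ell k (∑ j, w j • pentVertex (j : Fin 5)) = 0 ↔ ∀ j, w j ≠ 0 → j = k ∨ j = k + 1 := by
  rw [ell_sum k w hw, Finset.sum_eq_zero_iff_of_nonneg fun j _ => mul_nonneg (hw.1 j) (ell_pv_nonneg k j)]
  simp only [Finset.mem_univ, true_imp_iff, mul_eq_zero, ell_pv_iff]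
  exact forall_congr' fun j => by tauto

theorem ell_nonneg (k : Fin 5) (z : ℂ) (hz : z ∈ Pentagon) : 0 ≤ ell k z := by
  obtain ⟨w, hw, rfl⟩ := (pent_mem z).1 hz
  rw [ell_sum k w hw]
  exact Finset.sum_nonneg fun j _ => mul_nonneg (hw.1 j) (ell_pv_nonneg k j)

theorem ell_affine (k : Fin 5) (z z' : ℂ) (t : ℝ) :
    ell k ((1 - t) • z + t • z') = (1 - t) * ell k z + t * ell k z' := by
  simp only [ell, map_add, map_smul, smul_eq_mul]; ring

theorem ell_seg (k : Fin 5) (z : ℂ) (hz : z ∈ Pentagon) :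
    z ∈ segment ℝ (pentVertex (k : ℕ)) (pentVertex ((k : ℕ) + 1)) ↔ ell k z = 0 := by
  rw [pv_succ]
  constructor
  · rintro ⟨a, b, ha, hb, hab, rfl⟩
    obtain rfl : a = 1 - b := by linarith
    rw [ell_affine, ell_pv_zero k k (Or.inl rfl), ell_pv_zero k (k + 1) (Or.inr rfl)]; simp
  · intro h
    obtain ⟨w, hw, rfl⟩ := (pent_mem z).1 hz
    rw [ell_sum_zero k w hw] at h
    have hne : k ≠ k + 1 := by clear h; revert k; decide
    have h0 : ∀ j ∉ ({k, k + 1} : Finset (Fin 5)), w j = 0 := fun j hj => by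
      by_contra h'
      exact hj (by simpa using h j h')
    refine ⟨w k, w (k + 1), hw.1 _, hw.1 _, ?_, ?_⟩
    · rw [← hw.2, ← Finset.sum_subset (Finset.subset_univ {k, k + 1}) fun j _ hj => h0 j hj,
        Finset.sum_pair hne]
    · rw [← Finset.sum_subset (Finset.subset_univ {k, k + 1}) fun j _ hj => by rw [h0 j hj, zero_smul],
        Finset.sum_pair hne]

theorem ell_disj (a b : Fin 5) (h : ¬ adj5 a b) (z : ℂ) (hz : z ∈ Pentagon) :
    ¬ (ell a z = 0 ∧ ell b z = 0) := by
  obtain ⟨w, hw, rfl⟩ := (pent_mem z).1 hz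
  rw [ell_sum_zero a w hw, ell_sum_zero b w hw]
  rintro ⟨h1, h2⟩
  have : ∀ j, w j = 0 := fun j => by
    by_contra h'
    have g1 := h1 j h'
    have g2 := h2 j h'
    clear h' h1 h2
    revert a b j; decide
  have h3 := hw.2
  simp [this] at h3

set_option maxRecDepth 10000 in
theorem ell_flag_comb : ∀ T : Finset (Fin 5), (∀ a ∈ T, ∀ b ∈ T, adj5 a b) →
    ∃ U : Finset (Fin 5), U.Nonempty ∧ ∀ k, (∀ j ∈ U, j = k ∨ j = k + 1) ↔ k ∈ T := by
  decide

theorem ell_flag (T : Finset (Fin 5)) (h : ∀ a ∈ T, ∀ b ∈ T, adj5 a b) :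
    ∃ z ∈ Pentagon, ∀ k, ell k z = 0 ↔ k ∈ T := by
  obtain ⟨U, hU, hUT⟩ := ell_flag_comb T h
  have hc : (0 : ℝ) < U.card := by exact_mod_cast hU.card_pos
  let w : Fin 5 → ℝ := fun j => if j ∈ U then (U.card : ℝ)⁻¹ else 0
  have hw : w ∈ stdSimplex ℝ (Fin 5) := by
    constructor
    · intro j; simp only [w]; split_ifs <;> positivity
    · simp only [w, Finset.sum_ite_mem, Finset.univ_inter, Finset.sum_const, nsmul_eq_mul]
      exact mul_inv_cancel₀ hc.ne'
  refine ⟨_, (pent_mem _).2 ⟨w, hw, rfl⟩, fun k => ?_⟩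
  rw [ell_sum_zero k w hw, ← hUT]
  refine forall_congr' fun j => ?_
  by_cases hj : j ∈ U <;> simp [w, hj, hc.ne']

abbrev PP (m : ℕ) : Type := Pentagon × (Fin m → (Set.Icc (-1 : ℝ) 1))

def el {m : ℕ} : Fc m → PP m → ℝ
  | .inl k, p => ell k p.1
  | .inr (i, true), p => 1 - (p.2 i : ℝ)
  | .inr (i, false), p => 1 + (p.2 i : ℝ)

theorem conv_Pent : Convex ℝ Pentagon := convex_convexHull _ _

def cvx {m : ℕ} (p q : PP m) (t : unitInterval) : PP m :=
  (⟨(1 - t.1) • (p.1 : ℂ) + t.1 • (q.1 : ℂ), conv_Pent p.1.2 q.1.2 (by linarith [t.2.2]) t.2.1 (by ring)⟩,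
    fun i => ⟨(1 - t.1) • (p.2 i : ℝ) + t.1 • (q.2 i : ℝ), convex_Icc (-1 : ℝ) 1 (p.2 i).2 (q.2 i).2
      (by linarith [t.2.2]) t.2.1 (by ring)⟩)

theorem rel_equiv (n : ℕ) : Equivalence (pentCoverRel n) where
  refl x := ⟨rfl, by rw [Gp_add_self]; exact Submodule.zero_mem _⟩
  symm := fun {x y} h => ⟨h.1.symm, by rw [add_comm, ← h.1]; exact h.2⟩
  trans := fun {x y z} h h' => ⟨h.1.trans h'.1, by
    have e : x.1 + z.1 = (x.1 + y.1) + (y.1 + z.1) := by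
      rw [add_assoc, ← add_assoc y.1, Gp_add_self, zero_add]
    rw [e]
    exact Submodule.add_mem _ h.2 (by rw [h.1]; exact h'.2)⟩

def chi {m : ℕ} : Fc m → Gp (m + 2)
  | .inl k => pentEdgeVal (m + 2) k
  | .inr (i, _) => eVec (m + 2) (i : ℕ)

theorem gen_eq {m : ℕ} (p : PP m) :
    pentGenSet (m + 2) p = {v | ∃ F, el F p = 0 ∧ v = chi F} := by
  ext v
  constructor
  · rintro (⟨i, h | h, rfl⟩ | ⟨k, h, rfl⟩)
    · refine ⟨.inr (i, false), ?_, rfl⟩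
      simp only [el]; linarith
    · refine ⟨.inr (i, true), ?_, rfl⟩
      simp only [el]; linarith
    · exact ⟨.inl k, (ell_seg k _ p.1.2).1 h, rfl⟩
  · rintro ⟨k | ⟨i, s⟩, h, rfl⟩
    · exact Or.inr ⟨k, (ell_seg k _ p.1.2).2 h, rfl⟩
    · refine Or.inl ⟨i, ?_, rfl⟩
      cases s
      · left; simp only [el] at h; linarith
      · right; simp only [el] at h; linarith

def MM (m : ℕ) : Mir (m + 2) (PP m) (Fc m) (PentCover (m + 2)) where
  ℓ := el
  ℓ_cont := by
    rintro (k | ⟨i, s⟩)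
    · exact (ell_cont k).comp (by fun_prop)
    · cases s
      · change Continuous fun p : PP m => 1 + (p.2 i : ℝ)
        fun_prop
      · change Continuous fun p : PP m => 1 - (p.2 i : ℝ)
        fun_prop
  ℓ_nonneg := by
    rintro (k | ⟨i, s⟩) p
    · exact ell_nonneg k _ p.1.2
    · have := (p.2 i).2
      cases s <;> simp only [el]
      · linarith [this.1]
      · linarith [this.2]
  χ := chi
  cv := cvx
  cv_cont := by
    intro q
    unfold cvx
    refine Continuous.prodMk (Continuous.subtype_mk (by fun_prop) _)
      (continuous_pi fun i => Continuous.subtype_mk (by fun_prop) _)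
  cv_ℓ := by
    rintro (k | ⟨i, s⟩) p q t
    · exact ell_affine k _ _ _
    · cases s <;> simp only [el, cvx, smul_eq_mul] <;> ring
  cv_zero := by
    intro p q
    refine Prod.ext (Subtype.ext ?_) (funext fun i => Subtype.ext ?_) <;> simp [cvx]
  cv_one := by
    intro p q
    refine Prod.ext (Subtype.ext ?_) (funext fun i => Subtype.ext ?_) <;> simp [cvx]
  compat := cmp
  compat_symm := by
    rintro (k | ⟨i, s⟩) (k' | ⟨i', s'⟩) h
    · revert h; simp only [cmp]; revert k k'; decide
    · trivial
    · trivial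
    · exact fun h' => (h h'.symm).symm
  disj := by
    rintro (k | ⟨i, s⟩) (k' | ⟨i', s'⟩) h p
    · exact ell_disj k k' h _ p.1.2
    · exact absurd trivial h
    · exact absurd trivial h
    · simp only [cmp] at h
      push Not at h
      obtain ⟨rfl, h⟩ := h
      rintro ⟨h1, h2⟩
      cases s <;> cases s' <;> simp only [el] at h1 h2
      · exact h rfl
      · linarith
      · linarith
      · exact h rfl
  flag := by
    intro A hA
    obtain ⟨z, hz, hzT⟩ := ell_flag (Finset.univ.filter fun k => (.inl k : Fc m) ∈ A)
      fun a ha b hb => hA (.inl a) (by simpa using ha) (.inl b) (by simpa using hb)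
    refine ⟨(⟨z, hz⟩, fun i => if (.inr (i, true) : Fc m) ∈ A then ⟨1, by norm_num⟩ else
      if (.inr (i, false) : Fc m) ∈ A then ⟨-1, by norm_num⟩ else ⟨0, by norm_num⟩), ?_⟩
    rintro (k | ⟨i, s⟩)
    · exact (hzT k).trans (by simp)
    · have hi : ¬ ((.inr (i, true) : Fc m) ∈ A ∧ (.inr (i, false) : Fc m) ∈ A) := fun ⟨h1, h2⟩ => by
        have := hA _ h1 _ h2
        simp [cmp] at this
      by_cases h1 : (.inr (i, true) : Fc m) ∈ A <;> by_cases h2 : (.inr (i, false) : Fc m) ∈ A <;>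
        cases s <;> simp [el, h1, h2] <;> tauto
  q := fun x => Quot.mk (pentCoverRel (m + 2)) x
  q_quot := isQuotientMap_quot_mk
  q_eq := by
    intro g p g' p'
    have e : (Quot.mk (pentCoverRel (m + 2)) (g, p) = Quot.mk (pentCoverRel (m + 2)) (g', p')) ↔
        pentCoverRel (m + 2) (g, p) (g', p') := by
      rw [Quot.eq, (rel_equiv _).eqvGen_iff]
    refine e.trans ?_
    rw [← gen_eq]; rfl

theorem HT_MM (m : ℕ) (ω : Gp (m + 2)) : HT ((MM m).C ω Finset.univ) (dg (Φ m ω)) :=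
  HT_univ (MM m) rfl (fun _ => rfl) (fun _ _ => rfl) ω

end PC

end

open Complex CategoryTheory

noncomputable section

namespace PC

theorem rank_sc (S : ShortComplex (ModuleCat.{0} ℚ)) {ι : Type} [Fintype ι] (z : ι → S.X₂)
    (hz : ∀ i, S.g (z i) = 0)
    (hspan : ∀ x, S.g x = 0 → ∃ y, ∃ c : ι → ℚ, x = S.f y + ∑ i, c i • z i)
    (hind : ∀ (c : ι → ℚ) y, S.f y = ∑ i, c i • z i → c = 0) :
    Module.rank ℚ S.homology = (Fintype.card ι : Cardinal) := by
  rw [S.moduleCatHomologyIso.toLinearEquiv.rank_eq]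
  let zz : ι → LinearMap.ker S.g.hom := fun i => ⟨z i, hz i⟩
  let Q : Submodule ℚ (LinearMap.ker S.g.hom) := LinearMap.range S.moduleCatToCycles
  let φ : (ι → ℚ) →ₗ[ℚ] (LinearMap.ker S.g.hom ⧸ Q) :=
    Q.mkQ ∘ₗ Fintype.linearCombination ℚ zz
  have hval : ∀ c, ((Fintype.linearCombination ℚ zz c : LinearMap.ker S.g.hom) : S.X₂) =
      ∑ i, c i • z i := fun c => by
    rw [Fintype.linearCombination_apply, Submodule.coe_sum]; rfl
  have hb : Function.Bijective φ := by
    constructor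
    · rw [← LinearMap.ker_eq_bot, LinearMap.ker_eq_bot']
      intro c hc
      have hc : Fintype.linearCombination ℚ zz c ∈ Q := (Submodule.Quotient.mk_eq_zero _).1 hc
      obtain ⟨y, hy⟩ := hc
      refine hind c y ?_
      rw [← hval, ← hy]; rfl
    · intro x
      obtain ⟨x, rfl⟩ := Submodule.Quotient.mk_surjective _ x
      obtain ⟨y, c, h⟩ := hspan x.1 x.2
      refine ⟨c, ?_⟩
      refine (Submodule.Quotient.eq Q).2 ⟨-y, ?_⟩
      apply Subtype.ext
      have e : ((Fintype.linearCombination ℚ zz c - x : LinearMap.ker S.g.hom) : S.X₂) =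
        ∑ i, c i • z i - x.1 := by rw [← hval]; rfl
      rw [e, h, map_neg, sub_add_cancel_right]; rfl
  have := (LinearEquiv.ofBijective φ hb).rank_eq
  refine Eq.trans (Eq.symm this) ?_
  simp

variable (X : Type) [TopologicalSpace X]

abbrev SS : SSet := TopCat.toSSet.obj (TopCat.of X)

abbrev FS : SimplicialObject (ModuleCat.{0} ℚ) :=
  ((SimplicialObject.whiskering _ _).obj (ModuleCat.free ℚ)).obj (SS X)

abbrev KK : ChainComplex (ModuleCat.{0} ℚ) ℕ :=
  (AlgebraicTopology.alternatingFaceMapComplex (ModuleCat.{0} ℚ)).obj (FS X)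

abbrev Sm (i : ℕ) : Type := (SS X).obj (Opposite.op (SimplexCategory.mk i))

def eqv (i : ℕ) : Sm X i ≃ C(E (i + 1), X) :=
  TopCat.toSSetObjEquiv (TopCat.of X) (Opposite.op (SimplexCategory.mk i))

def J0 (i : ℕ) : (Sm X i →₀ ℚ) →ₗ[ℚ] Ch X :=
  Finsupp.lmapDomain ℚ ℚ fun s => (⟨i, eqv X i s⟩ : Sg X)

theorem J0_single (i : ℕ) (s : Sm X i) : J0 X i (Finsupp.single s 1) = sg (eqv X i s) := by
  simp [J0]

theorem J0_inj (i : ℕ) : Function.Injective (J0 X i) := by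
  apply Finsupp.mapDomain_injective
  intro s t h
  have : eqv X i s = eqv X i t := by simpa using h
  exact (eqv X i).injective this

theorem J0_pr (i : ℕ) (x) : pr i (J0 X i x) = J0 X i x := by
  have : (pr i ∘ₗ J0 X i) = J0 X i := by
    apply Finsupp.lhom_ext'
    intro s
    apply LinearMap.ext_ring
    simp only [LinearMap.comp_apply, Finsupp.lsingle_apply, J0_single, pr_sg, if_true]
  exact LinearMap.congr_fun this x

theorem J0_surj (i : ℕ) (x : Ch X) : ∃ y, J0 X i y = pr i x := by
  suffices h : LinearMap.range (pr (X := X) i) ≤ LinearMap.range (J0 X i) from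
    h ⟨x, rfl⟩
  rintro _ ⟨x, rfl⟩
  induction x using Finsupp.induction_linear with
  | zero => rw [map_zero]; exact Submodule.zero_mem _
  | add f g hf hg => rw [map_add]; exact Submodule.add_mem _ hf hg
  | single a b =>
    obtain ⟨k, σ⟩ := a
    have : Finsupp.single (⟨k, σ⟩ : Sg X) b = b • sg σ := by simp
    rw [this, map_smul, pr_sg]
    refine Submodule.smul_mem _ _ ?_
    split_ifs with h
    · subst h
      exact ⟨Finsupp.single ((eqv X k).symm σ) 1, by rw [J0_single, Equiv.apply_symm_apply]⟩
    · exact Submodule.zero_mem _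

theorem eqv_δ (i : ℕ) (j : Fin (i + 2)) (s : Sm X (i + 1)) :
    eqv X i ((SS X).δ j s) = (eqv X (i + 1) s).comp (aff (vert (i + 1 + 1) ∘ j.succAbove)) := by
  refine ContinuousMap.ext fun x => ?_
  have : aff (vert (i + 1 + 1) ∘ j.succAbove) x = stdSimplex.map (j.succAbove) x := by
    apply Subtype.ext
    funext l
    rw [aff_apply]
    refine Eq.trans ?_ (FunOnFinite.linearMap_apply_apply ℝ ℝ j.succAbove x.1 l).symm
    rw [Finset.sum_filter]
    refine Finset.sum_congr rfl fun a _ => ?_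
    simp only [vert, Function.comp, Pi.single_apply]
    by_cases h : j.succAbove a = l
    · simp [h]
    · simp [h, Ne.symm h]
  rw [ContinuousMap.comp_apply, this]
  rfl

def J (i : ℕ) : (KK X).X i →ₗ[ℚ] Ch X := J0 X i

theorem objD_J {V : Type} [AddCommGroup V] [Module ℚ V] (F : SimplicialObject (ModuleCat.{0} ℚ))
    (i : ℕ) (L : F.obj (Opposite.op (SimplexCategory.mk i)) →ₗ[ℚ] V)
    (u : F.obj (Opposite.op (SimplexCategory.mk (i + 1)))) :
    L ((AlgebraicTopology.AlternatingFaceMapComplex.objD F i).hom u) =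
      ∑ j : Fin (i + 1 + 1), (-1 : ℚ) ^ (j : ℕ) • L ((F.δ j).hom u) := by
  rw [AlgebraicTopology.AlternatingFaceMapComplex.objD, ModuleCat.hom_sum,
    LinearMap.sum_apply, map_sum]
  refine Finset.sum_congr rfl fun j _ => ?_
  rw [ModuleCat.hom_zsmul, LinearMap.smul_apply, map_zsmul, ← Int.cast_smul_eq_zsmul ℚ]
  push_cast; rfl

theorem J_d (i : ℕ) (x : (KK X).X (i + 1)) : J X i ((KK X).d (i + 1) i x) = dM (J X (i + 1) x) := by
  have : (J X i) ∘ₗ ((KK X).d (i + 1) i).hom = dM ∘ₗ J X (i + 1) := by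
    apply Finsupp.lhom_ext'
    intro s
    apply LinearMap.ext_ring
    rw [AlgebraicTopology.alternatingFaceMapComplex_obj_d]
    refine (objD_J (FS X) i (J0 X i) (Finsupp.single s 1 : Sm X (i + 1) →₀ ℚ)).trans ?_
    change _ = dM (J0 X (i + 1) (Finsupp.single s 1))
    rw [J0_single, dM_sg]
    refine Finset.sum_congr rfl fun j _ => congrArg _ ?_
    have e : ((FS X).δ j).hom
      (Finsupp.single s 1 : Sm X (i + 1) →₀ ℚ) = (Finsupp.single ((SS X).δ j s) 1 : Sm X i →₀ ℚ) :=
      Finsupp.mapDomain_single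
    refine (congrArg (J0 X i) e).trans ?_
    rw [J0_single, eqv_δ]
  exact LinearMap.congr_fun this x

end PC

end

open Complex CategoryTheory

noncomputable section

namespace PC

theorem chr_comm {n : ℕ} (ω g : Gp n) : chr ω g = chr g ω := by
  simp only [chr, mul_comm]

theorem sum_chr {n : ℕ} (ω : Gp n) : ∑ g, chr ω g = if ω = 0 then (2 : ℚ) ^ n else 0 := by
  split_ifs with h
  · subst h
    have : ∀ g : Gp n, chr 0 g = 1 := fun g => by rw [chr_comm, chr_zero]
    simp [this]
  · obtain ⟨j, hj⟩ : ∃ j, ω j ≠ 0 := by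
      by_contra h'
      push Not at h'
      exact h (funext h')
    have h1 : chr ω (eVec n j) ≠ 1 := (chr_eVec ω j).2 hj
    have h2 : ∑ g, chr ω g = chr ω (eVec n j) * ∑ g, chr ω g := by
      rw [Finset.mul_sum, ← Equiv.sum_comp (Equiv.addLeft (eVec n j))]
      exact Finset.sum_congr rfl fun g _ => by rw [Equiv.coe_addLeft, chr_add]
    have h3 : (1 - chr ω (eVec n j)) * ∑ g, chr ω g = 0 := by rw [sub_mul, one_mul, ← h2, sub_self]
    rcases mul_eq_zero.1 h3 with h4 | h4
    · exact absurd (by linarith) h1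
    · exact h4

theorem pr_pr {X : Type} [TopologicalSpace X] (i k : ℕ) (x : Ch X) :
    pr i (pr k x) = if i = k then pr k x else 0 := by
  have : pr i ∘ₗ pr k = (if i = k then pr k else 0 : Ch X →ₗ[ℚ] Ch X) := by
    apply LinearMap.ext
    refine Ch_ext fun j σ => ?_
    rw [LinearMap.comp_apply, pr_sg]
    by_cases h1 : j = k <;> by_cases h2 : i = k <;> simp only [h1, h2, if_true, if_false, map_zero, LinearMap.zero_apply, pr_sg]
    · simp [pr_sg, h1, Ne.symm h2]
  have := LinearMap.congr_fun this x
  rw [LinearMap.comp_apply] at this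
  rw [this]; split_ifs <;> rfl

theorem d_pr0 {X : Type} [TopologicalSpace X] (x : Ch X) : dM (pr 0 x) = 0 := by
  have : dM ∘ₗ pr 0 = (0 : Ch X →ₗ[ℚ] Ch X) := by
    apply LinearMap.ext
    refine Ch_ext fun j σ => ?_
    rw [LinearMap.comp_apply, pr_sg]
    split_ifs with h
    · subst h; exact dM_sg0 _
    · simp
  exact LinearMap.congr_fun this x

section
variable {n : ℕ} {P 𝓕 X : Type} [TopologicalSpace P] [TopologicalSpace X]
  (M : Mir n P 𝓕 X) [DecidableEq 𝓕] [Fintype 𝓕]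

theorem e_memU (ω : Gp n) (x : Ch X) : M.e ω x ∈ M.C ω Finset.univ := by
  apply M.e_mem
  have : M.XA Finset.univ = Set.univ := by ext x; simp [Mir.XA, Mir.U]
  rw [this, SC]; simp

theorem sum_e (x : Ch X) : ∑ ω, M.e ω x = x := by
  simp only [M.e_apply, ← Finset.smul_sum]
  rw [Finset.sum_comm]
  have : ∀ g : Gp n, ∑ ω, chr ω g • pM (M.act g) x = if g = 0 then (2 : ℚ) ^ n • x else 0 := by
    intro g
    rw [← Finset.sum_smul]
    simp only [chr_comm _ g, sum_chr]
    split_ifs with h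
    · subst h
      rw [M.act_zero]
      have : pM (ContinuousMap.id X) x = x := by
        have := Ch_ext (f := pM (ContinuousMap.id X)) (g := LinearMap.id) (fun k σ => by
          rw [pM_sg, ContinuousMap.id_comp]; rfl) x
        exact this
      rw [this]
    · simp
  simp only [this, Finset.sum_ite_eq', Finset.mem_univ, if_true, smul_smul]
  rw [inv_mul_cancel₀ (by positivity), one_smul]

theorem e_orth {ω ω' : Gp n} (h : ω ≠ ω') {A : Finset 𝓕} {x : Ch X} (hx : x ∈ M.C ω' A) :
    M.e ω x = 0 := by
  rw [M.e_apply]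
  have hx := (M.mem_C.1 hx).2
  have : ∀ g, chr ω g • pM (M.act g) x = chr (ω + ω') g • x := fun g => by
    rw [hx, smul_smul, chr_comm (ω + ω'), chr_add, chr_comm g, chr_comm g]
  simp only [this, ← Finset.sum_smul, sum_chr]
  have h' : ω + ω' ≠ 0 := fun h' => h (by rw [← Gp_neg ω']; exact eq_neg_of_add_eq_zero_left h')
  simp [h']

theorem rank_homology (D : Gp n → Option ℕ) (hD : ∀ ω, HT (M.C ω Finset.univ) (D ω)) (i : ℕ) :
    Module.rank ℚ ((KK X).homology i) = (Fintype.card {ω // D ω = some i} : Cardinal) := by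
  have hex : ∀ ω : {ω // D ω = some i}, Sph (M.C ω.1 Finset.univ) i := fun ω => by
    have := hD ω.1; rw [ω.2] at this; exact this
  choose z hz1 hz2 hz3 hz4 hz5 using hex
  have hzK : ∀ ω, ∃ y : (KK X).X i, J X i y = z ω := fun ω => by
    obtain ⟨y, hy⟩ := J0_surj X i (z ω)
    exact ⟨y, by rw [← hz2 ω]; exact hy⟩
  choose zK hzK using hzK
  have hk : (ComplexShape.down ℕ).next i = i - 1 := by
    cases i with
    | zero => exact ChainComplex.next_nat_zero
    | succ i => exact ChainComplex.next_nat_succ i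
  have hg : ∀ x : (KK X).X i, (KK X).d i (i - 1) x = 0 ↔ dM (J X i x) = 0 := by
    intro x
    cases i with
    | zero =>
      have h1 : (KK X).d 0 (0 - 1) = 0 := (KK X).shape _ _ (by simp)
      have h2 : dM (J X 0 x) = 0 := by
        have := J0_pr X 0 x
        have h3 := d_pr0 (J X 0 x)
        rwa [show pr 0 (J X 0 x) = J X 0 x from this] at h3
      rw [h1]; simp [h2]
    | succ i =>
      rw [← J_d]
      exact ((J0_inj X i).eq_iff' (map_zero _)).symm
  rw [((KK X).homologyIsoSc' (i + 1) i (i - 1) (by simp) hk).toLinearEquiv.rank_eq]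
  have hsum : ∀ c : {ω // D ω = some i} → ℚ, J X i (∑ ω, c ω • zK ω) = ∑ ω, c ω • z ω := fun c => by
    rw [map_sum]; exact Finset.sum_congr rfl fun ω _ => by rw [map_smul, hzK]
  have hspan : ∀ x : (KK X).X i, (KK X).d i (i - 1) x = 0 → ∃ y : (KK X).X (i + 1),
      ∃ c : {ω // D ω = some i} → ℚ, x = (KK X).d (i + 1) i y + ∑ ω, c ω • zK ω := by
    intro x hx
    have hx : dM (J X i x) = 0 := (hg _).1 hx
    have hp : pr i (J X i x) = J X i x := J0_pr X i x
    have key : ∀ ω, ∃ y : Ch X, ∃ c : ℚ, M.e ω (J X i x) = dM (pr (i + 1) y) +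
        if h : D ω = some i then c • z ⟨ω, h⟩ else 0 := by
      intro ω
      have h1 := e_memU M ω (J X i x)
      have h2 : dM (M.e ω (J X i x)) = 0 := by rw [M.d_e, hx, map_zero]
      have h3 : pr i (M.e ω (J X i x)) = M.e ω (J X i x) := by rw [M.pr_e, hp]
      by_cases h : D ω = some i
      · obtain ⟨y, _, c, hy⟩ := hz4 ⟨ω, h⟩ _ h1 h2
        refine ⟨y, c, ?_⟩
        rw [dif_pos h, d_pr, ← h3, hy, map_add, map_smul, hz2]
      · suffices h' : ∃ y, M.e ω (J X i x) = dM (pr (i + 1) y) by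
          obtain ⟨y, hy⟩ := h'
          exact ⟨y, 0, by rw [dif_neg h, add_zero]; exact hy⟩
        have hDω := hD ω
        rcases hd : D ω with _ | k
        · rw [hd] at hDω
          obtain ⟨y, _, hy⟩ := hDω _ h1 (by rw [h2]; exact Submodule.zero_mem _)
          rw [Submodule.mem_bot, sub_eq_zero] at hy
          refine ⟨y, ?_⟩
          rw [d_pr, ← hy, h3]
        · rw [hd] at hDω
          obtain ⟨w, hw1, hw2, hw3, hw4, hw5⟩ := hDω
          obtain ⟨y, _, c, hy⟩ := hw4 _ h1 h2
          refine ⟨y, ?_⟩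
          have hik : i ≠ k := fun e => h (by rw [hd, e])
          have hw0 : pr i w = 0 := by rw [← hw2, pr_pr, if_neg hik]
          rw [d_pr, ← h3, hy, map_add, map_smul, hw0, smul_zero, add_zero]
    choose y c hy using key
    obtain ⟨yK, hyK⟩ : ∃ yK : (KK X).X (i + 1), J X (i + 1) yK = pr (i + 1) (∑ ω, y ω) :=
      J0_surj X (i + 1) (∑ ω, y ω)
    refine ⟨yK, fun ω => c ω.1, ?_⟩
    have hJ : Function.Injective (J X i) := J0_inj X i
    refine hJ ?_
    rw [map_add, J_d, hsum (fun ω => c ω.1)]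
    rw [hyK, map_sum, map_sum, ← sum_e M (J X i x)]
    simp only [hy, Finset.sum_add_distrib]
    congr 1
    rw [← Finset.sum_subset (Finset.subset_univ (Finset.univ.filter fun ω => D ω = some i))
      (fun ω _ h => dif_neg (by simpa using h))]
    rw [Finset.sum_subtype (p := fun ω => D ω = some i) _ (by simp)]
    exact Finset.sum_congr rfl fun ω _ => by rw [dif_pos ω.2]
  have hind : ∀ (c : {ω // D ω = some i} → ℚ) (y : (KK X).X (i + 1)),
      (KK X).d (i + 1) i y = ∑ ω, c ω • zK ω → c = 0 := by
    intro c y hcy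
    have h1 : dM (J X (i + 1) y) = ∑ ω, c ω • z ω := by
      rw [← hsum, ← J_d]; exact congrArg _ hcy
    funext ω
    by_contra hc
    have hc : c ω ≠ 0 := hc
    refine hz5 ω ((c ω)⁻¹ • M.e ω.1 (J X (i + 1) y)) (Submodule.smul_mem _ _ (e_memU M _ _)) ?_
    rw [map_smul, M.d_e, h1, map_sum, Finset.sum_eq_single ω]
    · rw [map_smul, M.e_fix (M.mem_C.1 (hz1 ω)).2, smul_smul, inv_mul_cancel₀ hc, one_smul]
    · intro ω' _ hne
      rw [map_smul, e_orth M (fun e => hne (Subtype.ext e.symm)) (hz1 ω'), smul_zero]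
    · simp
  exact rank_sc ((KK X).sc' (i + 1) i (i - 1)) (ι := {ω // D ω = some i}) zK
    (fun ω => (hg _).2 (by rw [hzK]; exact hz3 ω)) hspan hind

end

end PC

end

theorem rationalBetti_pentCover (n i : ℕ) (hn : 3 ≤ n) (hi : i ≤ n) :
    rationalBetti (TopCat.of (PentCover n)) i = if Even i then
      ((2 * chooseInt (n - 2) ((i:ℤ) - 1) + (n - 2).choose i : ℕ) : Cardinal)
      else ((2 * chooseInt (n - 2) ((i:ℤ) - 1) + chooseInt (n - 2) ((i:ℤ) - 2) : ℕ) : Cardinal) := by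
  obtain ⟨m, rfl⟩ : ∃ m, n = m + 2 := ⟨n - 2, by omega⟩
  have h := PC.rank_homology (PC.MM m) (fun ω => PC.dg (PC.Φ m ω)) (PC.HT_MM m) i
  rw [PC.count] at h
  refine Eq.trans h ?_
  rw [Nat.add_sub_cancel]
  split_ifs <;> rfl
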